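/- arXiv:1008.0723 — 5 statements merged into one kernel-verified Lean document; each statement's English description precedes it below -/
import Mathlib

section
/- There exists a constant C > 0 such that for every prime p, every integer l ≥ 4, and every multiplicative subgroup R ⊆ F_p* with |R| ≥ C·min{ p^{(2l+2)/(5l−3)}, p^{(l+5)/(3l+3)} }, every element of F_p* is a sum of l elements of R; that is, F_p* ⊆ lR. -/
open Finset Pointwise

/-- `R` is (the image in `F_p` of) a multiplicative subgroup of `F_p^*`. -/
def IsMulSubgroup (p : ℕ) (R : Finset (ZMod p)) : Prop :=
  ∃ H : Subgroup (ZMod p)ˣ, (R : Set (ZMod p)) = Units.val '' (H : Set (ZMod p)ˣ)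

open Polynomial in
lemma sparse_mult {p : ℕ} [Fact p.Prime] (k : ℕ) : ∀ f : (ZMod p)[X], f ≠ 0 →
    (∀ j ∈ f.support, j < p) → (X - C 1) ^ k ∣ f → k < #f.support := by
  induction k with
  | zero =>
    intro f hf _ _
    exact Finset.card_pos.mpr (Polynomial.support_nonempty.mpr hf)
  | succ k ih =>
    intro f hf hj hd
    obtain ⟨m, hm⟩ := Polynomial.support_nonempty.mpr hf
    set g : (ZMod p)[X] := X * derivative f - C (m : ZMod p) * f with hg
    have hco : ∀ j, g.coeff j = ((j : ZMod p) - m) * f.coeff j := by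
      intro j
      rw [hg, coeff_sub, coeff_C_mul]
      cases j with
      | zero => simp
      | succ j => rw [coeff_X_mul, coeff_derivative]; push_cast; ring
    have hsupp : g.support = f.support.erase m := by
      ext j
      rw [Finset.mem_erase, mem_support_iff, mem_support_iff, hco]
      constructor
      · intro h
        refine ⟨?_, right_ne_zero_of_mul h⟩
        rintro rfl
        simp at h
      · rintro ⟨h1, h2⟩
        refine mul_ne_zero ?_ h2
        rw [sub_ne_zero]
        intro h
        apply h1
        have := (ZMod.natCast_eq_natCast_iff' j m p).1 h
        rwa [Nat.mod_eq_of_lt (hj j (mem_support_iff.2 h2)), Nat.mod_eq_of_lt (hj m hm)] at this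
    by_cases hg0 : g = 0
    · exfalso
      have h1 : f.support.erase m = ∅ := by rw [← hsupp, hg0]; simp
      have h2 : f.eval 1 = f.coeff m := by
        rw [eval_eq_sum, Polynomial.sum_def, Finset.sum_eq_single_of_mem m hm]
        · simp
        · intro b hb hbm
          have : b ∈ f.support.erase m := Finset.mem_erase.2 ⟨hbm, hb⟩
          rw [h1] at this
          simp at this
      have h3 : f.eval 1 = 0 := by
        have : (X - C 1) ∣ f := (dvd_pow_self _ (Nat.succ_ne_zero k)).trans hd
        exact dvd_iff_isRoot.1 this
      exact (mem_support_iff.1 hm) (h2 ▸ h3)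
    · have hdg : (X - C 1) ^ k ∣ g := by
        obtain ⟨q, rfl⟩ := hd
        rw [hg]
        refine dvd_sub ?_ ?_
        · refine Dvd.dvd.mul_left ?_ _
          rw [derivative_mul]
          refine dvd_add ?_ ?_
          · refine Dvd.dvd.mul_right ?_ _
            rw [derivative_X_sub_C_pow]
            simp
          · refine Dvd.dvd.mul_right ?_ _
            exact pow_dvd_pow _ (Nat.le_succ k)
        · refine Dvd.dvd.mul_left (Dvd.dvd.mul_right (pow_dvd_pow _ (Nat.le_succ k)) _) _
      have := ih g hg0 (by intro j hjj; rw [hsupp] at hjj; exact hj j (Finset.mem_of_mem_erase hjj)) hdg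
      rw [hsupp, Finset.card_erase_of_mem hm] at this
      omega

open Polynomial in
/-- The derivation `X (X - 1) d/dX`. -/
noncomputable def thetaOp (p : ℕ) : (ZMod p)[X] →ₗ[ZMod p] (ZMod p)[X] :=
  (LinearMap.mulLeft (ZMod p) (X * (X - 1))).comp derivative

open Polynomial in
lemma thetaOp_apply {p : ℕ} (f : (ZMod p)[X]) : thetaOp p f = X * (X - 1) * derivative f := rfl

open Polynomial in
noncomputable def twOp (p t b c : ℕ) : (ZMod p)[X] →ₗ[ZMod p] (ZMod p)[X] :=
  thetaOp p + LinearMap.mulLeft (ZMod p)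
    (C ((t * b : ℕ) : ZMod p) * (X - 1) + C ((t * c : ℕ) : ZMod p) * X)

open Polynomial in
lemma twOp_apply {p : ℕ} (t b c : ℕ) (f : (ZMod p)[X]) : twOp p t b c f =
    X * (X - 1) * derivative f +
    (C ((t * b : ℕ) : ZMod p) * (X - 1) + C ((t * c : ℕ) : ZMod p) * X) * f := rfl

open Polynomial in
lemma theta_mult {p : ℕ} [Fact p.Prime] (y : ZMod p) (h0 : y ≠ 0) (h1 : y ≠ 1) (D : ℕ) :
    D ≤ p → ∀ f : (ZMod p)[X], (∀ n < D, ((thetaOp p ^ n) f).eval y = 0) →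
    (X - C y) ^ D ∣ f := by
  induction D with
  | zero => intro _ f _; simp
  | succ D ih =>
    intro hD f hf
    rcases Nat.eq_zero_or_pos D with rfl | hpos
    · have := hf 0 (by omega)
      simp only [pow_zero, Module.End.one_apply] at this
      simpa using dvd_iff_isRoot.2 this
    obtain ⟨g, hg⟩ := ih (by omega) f (fun n hn => hf n (by omega))
    obtain ⟨k, hk⟩ := ih (by omega) (thetaOp p f) (fun n hn => by
      have := hf (n+1) (by omega)
      rwa [pow_succ, Module.End.mul_apply] at this)
    rw [thetaOp_apply, hg, derivative_mul, derivative_X_sub_C_pow] at hk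
    have hne : (X - C y) ^ (D - 1) ≠ 0 := pow_ne_zero _ (X_sub_C_ne_zero y)
    have hpw : (X - C y) ^ D = (X - C y) ^ (D - 1) * (X - C y) := by
      rw [← pow_succ]; congr 1; omega
    have key : X * (X - 1) * (C (D : ZMod p) * g) =
        (X - C y) * (k - X * (X - 1) * derivative g) := by
      apply mul_left_cancel₀ hne
      have e := hk
      rw [hpw] at e
      linear_combination e
    have hev := congrArg (eval y) key
    simp only [eval_mul, eval_X, eval_sub, eval_one, eval_C, sub_self, zero_mul] at hev
    have hDne : (D : ZMod p) ≠ 0 := by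
      rw [Ne, ZMod.natCast_eq_zero_iff]
      exact Nat.not_dvd_of_pos_of_lt hpos (by omega)
    have hgy : g.eval y = 0 := by
      have : y * (y - 1) * (D : ZMod p) ≠ 0 := mul_ne_zero (mul_ne_zero h0 (sub_ne_zero.2 h1)) hDne
      rcases mul_eq_zero.1 (show (y * (y - 1) * (D : ZMod p)) * g.eval y = 0 by
        linear_combination hev) with h | h
      · exact absurd h this
      · exact h
    rw [hg, pow_succ]
    exact mul_dvd_mul_left _ (dvd_iff_isRoot.2 hgy)

open Polynomial in
lemma X_mul_deriv_pow {p : ℕ} (m : ℕ) :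
    (X : (ZMod p)[X]) * derivative (X ^ m) = C (m : ZMod p) * X ^ m := by
  cases m with
  | zero => simp
  | succ m => simp; ring

open Polynomial in
lemma X_sub_mul_deriv_pow {p : ℕ} (m : ℕ) :
    ((X : (ZMod p)[X]) - 1) * derivative ((X - 1) ^ m) = C (m : ZMod p) * (X - 1) ^ m := by
  cases m with
  | zero => simp
  | succ m => simp [derivative_pow]; ring

open Polynomial in
lemma theta_tw {p : ℕ} (t b c : ℕ) (n : ℕ) (f : (ZMod p)[X]) :
    (thetaOp p ^ n) (f * X ^ (t * b) * (X - 1) ^ (t * c)) =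
      (twOp p t b c ^ n) f * X ^ (t * b) * (X - 1) ^ (t * c) := by
  induction n with
  | zero => simp
  | succ n ih =>
    rw [pow_succ', Module.End.mul_apply, ih, pow_succ', Module.End.mul_apply, thetaOp_apply,
      twOp_apply, derivative_mul, derivative_mul]
    have e1 := X_mul_deriv_pow (p := p) (t * b)
    have e2 := X_sub_mul_deriv_pow (p := p) (t * c)
    set q := (twOp p t b c ^ n) f
    linear_combination (X - 1) * q * (X - 1) ^ (t * c) * e1 + X * q * X ^ (t * b) * e2

open Polynomial in
lemma tw_degree {p : ℕ} (t b c : ℕ) (A n : ℕ) (f : (ZMod p)[X])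
    (hf : f.degree < A) : ((twOp p t b c ^ n) f).degree < (A + n : ℕ) := by
  induction n with
  | zero => simpa using hf
  | succ n ih =>
    rw [pow_succ', Module.End.mul_apply]
    set q := (twOp p t b c ^ n) f
    rw [degree_lt_iff_coeff_zero] at ih ⊢
    intro m hm
    obtain ⟨m, rfl⟩ : ∃ k, m = k + 1 := ⟨m - 1, by omega⟩
    have e : twOp p t b c q = X * (X * derivative q) - X * derivative q
      + (C ((t * b : ℕ) : ZMod p) * (X * q) - C ((t * b : ℕ) : ZMod p) * q
      + C ((t * c : ℕ) : ZMod p) * (X * q)) := by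
      rw [twOp_apply]; ring
    have h1 : q.coeff m = 0 := ih m (by omega)
    have h2 : q.coeff (m + 1) = 0 := ih _ (by omega)
    have h3 : (X * derivative q).coeff m = 0 := by
      cases m with
      | zero => simp
      | succ m => rw [coeff_X_mul, coeff_derivative, h1, zero_mul]
    rw [e]
    simp only [coeff_add, coeff_sub, coeff_C_mul, coeff_X_mul, coeff_derivative, h1, h2, h3]
    simp

open Polynomial in
/-- The auxiliary polynomial. -/
noncomputable def auxPoly {p : ℕ} (t B : ℕ) (v : Fin B × Fin B → (ZMod p)[X]) : (ZMod p)[X] :=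
  ∑ i, v i * X ^ (t * (i.1 : ℕ)) * (X - 1) ^ (t * (i.2 : ℕ))

open Polynomial in
lemma auxQ_coeff {p : ℕ} {t A B : ℕ} (hAt : A ≤ t)
    (w : Fin B → (ZMod p)[X]) (hw : ∀ b, (w b).degree < A) (b : Fin B) (a : ℕ) (ha : a < A) :
    (∑ b : Fin B, w b * X ^ (t * (b : ℕ))).coeff (t * b + a) = (w b).coeff a := by
  rw [finsetSum_coeff, Finset.sum_eq_single b]
  · rw [coeff_mul_X_pow', if_pos (by omega)]; congr 1; omega
  · intro b' _ hne
    rw [coeff_mul_X_pow']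
    split_ifs with h
    · apply coeff_eq_zero_of_degree_lt
      refine lt_of_lt_of_le (hw b') ?_
      have hne' : (b' : ℕ) ≠ b := fun h => hne (Fin.ext h)
      have : (b' : ℕ) < b := by
        rcases lt_or_gt_of_ne hne' with h' | h'
        · exact h'
        · exfalso
          have : t * ((b : ℕ) + 1) ≤ t * b' := Nat.mul_le_mul_left _ h'
          rw [mul_add] at this
          omega
      have h2 : t * ((b' : ℕ) + 1) ≤ t * b := Nat.mul_le_mul_left _ this
      rw [mul_add] at h2
      exact_mod_cast (by omega : A ≤ t * (b : ℕ) + a - t * b')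
    · rfl
  · simp

open Polynomial in
lemma auxQ_supp {p : ℕ} {t A B : ℕ}
    (w : Fin B → (ZMod p)[X]) (hw : ∀ b, (w b).degree < A) :
    (∑ b : Fin B, w b * X ^ (t * (b : ℕ))).support ⊆
      (Finset.univ : Finset (Fin B × Fin A)).image (fun i => t * (i.1 : ℕ) + i.2) := by
  intro j hj
  rw [mem_support_iff, finsetSum_coeff] at hj
  obtain ⟨b, _, hb⟩ := Finset.exists_ne_zero_of_sum_ne_zero hj
  rw [coeff_mul_X_pow'] at hb
  split_ifs at hb with h
  · have : j - t * b < A := by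
      by_contra hcon
      apply hb
      apply coeff_eq_zero_of_degree_lt
      refine lt_of_lt_of_le (hw b) ?_
      exact_mod_cast (not_lt.1 hcon)
    refine Finset.mem_image.2 ⟨(b, ⟨j - t * b, this⟩), Finset.mem_univ _, ?_⟩
    simp only
    omega
  · exact absurd rfl hb

open Polynomial in
lemma auxPoly_ne_zero {p : ℕ} [Fact p.Prime] {t A B : ℕ} (hAt : A ≤ t) (hAB : A * B ≤ t)
    (htB : t * B ≤ p) (v : Fin B × Fin B → (ZMod p)[X]) (hv : ∀ i, (v i).degree < A)
    (hne : v ≠ 0) : auxPoly t B v ≠ 0 := by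
  intro h0
  set Q : Fin B → (ZMod p)[X] := fun c => ∑ b : Fin B, v (b, c) * X ^ (t * (b : ℕ)) with hQ
  have hQ0 : ∃ c, Q c ≠ 0 := by
    by_contra hcon
    push Not at hcon
    apply hne
    funext ⟨b, c⟩
    ext a
    by_cases ha : a < A
    · have := auxQ_coeff hAt (fun b => v (b, c)) (fun b => hv _) b a ha
      rw [← this]
      have h2 := hcon c
      rw [hQ] at h2
      simp only at h2
      rw [h2]; simp
    · simp only [Pi.zero_apply, coeff_zero]
      apply coeff_eq_zero_of_degree_lt
      refine lt_of_lt_of_le (hv _) ?_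
      exact_mod_cast (not_lt.1 ha)
  have hsum : ∑ c : Fin B, Q c * (X - 1) ^ (t * (c : ℕ)) = 0 := by
    rw [← h0, auxPoly, Fintype.sum_prod_type_right]
    refine Finset.sum_congr rfl fun c _ => ?_
    rw [hQ, Finset.sum_mul]
  classical
  obtain ⟨c, hc, hmin⟩ : ∃ c, Q c ≠ 0 ∧ ∀ c' : Fin B, c' < c → Q c' = 0 := by
    have hne' : (Finset.univ.filter (fun c => Q c ≠ 0)).Nonempty := by
      obtain ⟨c, hc⟩ := hQ0
      exact ⟨c, by simp [hc]⟩
    refine ⟨(Finset.univ.filter (fun c => Q c ≠ 0)).min' hne', ?_, ?_⟩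
    · have := Finset.min'_mem _ hne'
      simpa using this
    · intro c' hc'
      by_contra hcon
      have := Finset.min'_le (Finset.univ.filter (fun c => Q c ≠ 0)) c' (by simp [hcon])
      exact absurd hc' (not_lt.2 this)
  have hdvd : (X - 1 : (ZMod p)[X]) ^ t ∣ Q c := by
    have hX : ((X - 1 : (ZMod p)[X]) ^ (t * (c : ℕ))) ≠ 0 := by
      have := X_sub_C_ne_zero (1 : ZMod p)
      rw [map_one] at this
      exact pow_ne_zero _ this
    have h1 : (X - 1 : (ZMod p)[X]) ^ (t * (c : ℕ)) * (X - 1) ^ t ∣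
        (X - 1 : (ZMod p)[X]) ^ (t * (c : ℕ)) * Q c := by
      rw [← Finset.add_sum_erase _ _ (Finset.mem_univ c)] at hsum
      rw [mul_comm _ (Q c), eq_neg_of_add_eq_zero_left hsum, dvd_neg]
      refine Finset.dvd_sum fun c' hc' => ?_
      rcases lt_trichotomy c' c with h | h | h
      · rw [hmin c' h]; simp
      · simp [h] at hc'
      · refine Dvd.dvd.mul_left ?_ _
        rw [← pow_add]
        apply pow_dvd_pow
        have : t * ((c : ℕ) + 1) ≤ t * c' := Nat.mul_le_mul_left _ h
        rw [mul_add] at this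
        omega
    exact (mul_dvd_mul_iff_left hX).1 h1
  have hs := auxQ_supp (t := t) (fun b => v (b, c)) (fun b => hv _)
  have := sparse_mult t (Q c) hc (by
    intro j hj
    obtain ⟨⟨b, a⟩, _, rfl⟩ := Finset.mem_image.1 (hs hj)
    simp only
    have h1 := a.2
    have h2 : t * ((b : ℕ) + 1) ≤ t * B := Nat.mul_le_mul_left _ b.2
    rw [mul_add] at h2
    omega) (by simpa using hdvd)
  have h3 := (Finset.card_le_card hs).trans Finset.card_image_le
  simp only [Finset.card_univ, Fintype.card_prod, Fintype.card_fin] at h3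
  rw [mul_comm] at h3
  have h4 : #(Q c).support ≤ A * B := h3
  omega

open Polynomial in
lemma auxPoly_natDegree {p : ℕ} [Fact p.Prime] {t A B : ℕ} (hAt : A ≤ t)
    (v : Fin B × Fin B → (ZMod p)[X]) (hv : ∀ i, (v i).degree < A) :
    (auxPoly t B v).natDegree ≤ 2 * t * B := by
  apply natDegree_sum_le_of_forall_le
  rintro ⟨b, c⟩ -
  have h1 : (v (b, c)).natDegree ≤ t := by
    apply natDegree_le_of_degree_le
    refine (hv (b, c)).le.trans ?_
    exact_mod_cast hAt
  have h2 : ((X - 1 : (ZMod p)[X]) ^ (t * (c : ℕ))).natDegree ≤ t * c := by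
    refine natDegree_pow_le.trans ?_
    have : (X - 1 : (ZMod p)[X]).natDegree = 1 := by simpa using natDegree_X_sub_C (1 : ZMod p)
    rw [this, mul_one]
  have h3 : ((X : (ZMod p)[X]) ^ (t * (b : ℕ))).natDegree ≤ t * b := natDegree_X_pow_le _
  refine natDegree_mul_le.trans ?_
  have := natDegree_mul_le (p := v (b, c)) (q := (X : (ZMod p)[X]) ^ (t * (b : ℕ)))
  have e1 : t * ((b : ℕ) + 1) ≤ t * B := Nat.mul_le_mul_left _ b.2
  have e2 : t * ((c : ℕ) + 1) ≤ t * B := Nat.mul_le_mul_left _ c.2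
  rw [mul_add] at e1 e2
  simp only
  rw [mul_assoc]
  omega

open Polynomial in
lemma exists_aux {p : ℕ} [Fact p.Prime] (t A B D : ℕ) (U : Finset (ZMod p))
    (h : #U * D * (A + D) < A * B * B) :
    ∃ v : Fin B × Fin B → (ZMod p)[X], (∀ i, (v i).degree < A) ∧ v ≠ 0 ∧
      ∀ u ∈ U, ∀ n < D, ∑ i, C (u ^ ((i.1 : ℕ) + i.2)) * (twOp p t i.1 i.2 ^ n) (v i) = 0 := by
  let L : (Fin B × Fin B → degreeLT (ZMod p) A) →ₗ[ZMod p] (U × Fin D × Fin (A + D) → ZMod p) :=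
    LinearMap.pi fun k => ∑ i : Fin B × Fin B, ((k.1 : ZMod p) ^ ((i.1 : ℕ) + i.2)) •
      ((lcoeff (ZMod p) (k.2.2 : ℕ)).comp ((twOp p t i.1 i.2 ^ (k.2.1 : ℕ)).comp
        ((degreeLT (ZMod p) A).subtype.comp (LinearMap.proj i))))
  have hfin : Module.finrank (ZMod p) (degreeLT (ZMod p) A) = A := by
    rw [(degreeLTEquiv (ZMod p) A).finrank_eq]; simp
  have : Module.Finite (ZMod p) (degreeLT (ZMod p) A) :=
    Module.Finite.equiv (degreeLTEquiv (ZMod p) A).symm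
  have hlt : Module.finrank (ZMod p) (U × Fin D × Fin (A + D) → ZMod p) <
      Module.finrank (ZMod p) (Fin B × Fin B → degreeLT (ZMod p) A) := by
    rw [Module.finrank_pi, Module.finrank_pi_fintype]
    simp only [hfin, Finset.sum_const, Finset.card_univ, Fintype.card_prod, Fintype.card_fin,
      Fintype.card_coe, smul_eq_mul]
    nlinarith
  have hker := LinearMap.ker_ne_bot_of_finrank_lt (f := L) hlt
  obtain ⟨v, hv, hv0⟩ := (Submodule.ne_bot_iff _).1 hker
  refine ⟨fun i => (v i : (ZMod p)[X]), fun i => mem_degreeLT.1 (v i).2, ?_, ?_⟩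
  · intro h0
    apply hv0
    funext i
    exact Subtype.ext (congrFun h0 i)
  · intro u hu n hn
    ext j
    rw [finsetSum_coeff]
    by_cases hj : j < A + D
    · have := congrFun (LinearMap.mem_ker.1 hv) (⟨u, hu⟩, ⟨n, hn⟩, ⟨j, hj⟩)
      simpa only [L, LinearMap.pi_apply, LinearMap.sum_apply, LinearMap.smul_apply, LinearMap.comp_apply, LinearMap.proj_apply, Submodule.subtype_apply, lcoeff_apply, smul_eq_mul, coeff_C_mul, coeff_zero, Pi.zero_apply] using this
    · rw [coeff_zero]
      refine Finset.sum_eq_zero fun i _ => ?_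
      rw [coeff_C_mul, coeff_eq_zero_of_degree_lt, mul_zero]
      refine lt_of_lt_of_le (tw_degree t _ _ A n _ (mem_degreeLT.1 (v i).2)) ?_
      exact_mod_cast (by omega : A + n ≤ j)

open Polynomial in
lemma stepanov_core {p : ℕ} [Fact p.Prime] (t A B D : ℕ) (ht : t ≠ 0) (U S : Finset (ZMod p))
    (hU : (0 : ZMod p) ∉ U) (hAt : A ≤ t) (hAB : A * B ≤ t) (htB : t * B ≤ p) (hD : D ≤ p)
    (h : #U * D * (A + D) < A * B * B)
    (hS : ∀ y ∈ S, y ^ t ∈ U ∧ (y - 1) ^ t = y ^ t) : D * #S ≤ 2 * t * B := by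
  obtain ⟨v, hv, hv0, hvan⟩ := exists_aux t A B D U h
  have hne := auxPoly_ne_zero hAt hAB htB v hv hv0
  refine le_trans ?_ (auxPoly_natDegree hAt v hv)
  have hdvd : ∀ y ∈ S, (X - C y) ^ D ∣ auxPoly t B v := by
    intro y hy
    obtain ⟨hy1, hy2⟩ := hS y hy
    apply theta_mult y _ _ D hD
    · intro n hn
      rw [auxPoly, map_sum, eval_finsetSum]
      have := congrArg (eval y) (hvan _ hy1 n hn)
      rw [eval_finsetSum, eval_zero] at this
      rw [← this]
      refine Finset.sum_congr rfl fun i _ => ?_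
      rw [theta_tw]
      simp only [eval_mul, eval_pow, eval_sub, eval_X, eval_one, eval_C]
      rw [pow_mul, pow_mul, hy2, pow_add]
      ring
    · rintro rfl
      rw [zero_pow ht] at hy1
      exact hU hy1
    · rintro rfl
      rw [sub_self, zero_pow ht] at hy2
      rw [← hy2] at hy1
      exact hU hy1
  have hprod : ∏ y ∈ S, (X - C y) ^ D ∣ auxPoly t B v := by
    apply Finset.prod_dvd_of_coprime _ hdvd
    intro a _ b _ hab
    exact (pairwise_coprime_X_sub_C (Function.injective_id) hab).pow
  have := natDegree_le_of_dvd hprod hne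
  rw [natDegree_prod_of_monic _ _ (fun y _ => (monic_X_sub_C y).pow D)] at this
  simp only [natDegree_pow, natDegree_X_sub_C, mul_one, Finset.sum_const, smul_eq_mul] at this
  rwa [mul_comm]

lemma stepanov_num {p : ℕ} [Fact p.Prime] (t : ℕ) (U S : Finset (ZMod p))
    (hU : (0 : ZMod p) ∉ U) (hU1 : 1 ≤ #U) (hUt : 256 * #U ^ 2 ≤ t) (htp : t ^ 3 ≤ p ^ 2)
    (hS : ∀ y ∈ S, y ^ t ∈ U ∧ (y - 1) ^ t = y ^ t) : #S ^ 3 ≤ 16384 * #U ^ 2 * t ^ 2 := by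
  set s := #U with hs
  have ht1 : 1 ≤ t := by nlinarith
  have hex : ∃ B : ℕ, 2 * s * t < B ^ 3 := ⟨2 * s * t + 1, by
    have : 2 * s * t + 1 ≤ (2 * s * t + 1) ^ 3 := Nat.le_self_pow (by norm_num) _
    omega⟩
  classical
  obtain ⟨B, hB, hmin⟩ : ∃ B : ℕ, 2 * s * t < B ^ 3 ∧ ∀ b < B, b ^ 3 ≤ 2 * s * t :=
    ⟨Nat.find hex, Nat.find_spec hex, fun b hb => not_lt.1 (Nat.find_min hex hb)⟩
  have hst : 1 ≤ s * t := Nat.mul_pos hU1 ht1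
  have hB2 : 2 ≤ B := by
    by_contra hcon
    have : B ^ 3 ≤ 1 ^ 3 := Nat.pow_le_pow_left (by omega) 3
    nlinarith
  obtain ⟨b, rfl⟩ : ∃ b, B = b + 1 := ⟨B - 1, by omega⟩
  have hb := hmin b (by omega)
  set B := b + 1 with hBdef
  have hB16 : B ^ 3 ≤ 16 * (s * t) := by
    have : B ^ 3 ≤ (2 * b) ^ 3 := Nat.pow_le_pow_left (by omega) 3
    rw [mul_pow] at this
    nlinarith
  have hBt : B ^ 2 ≤ t := by
    have h1 : (B ^ 2) ^ 3 ≤ t ^ 3 := by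
      calc (B ^ 2) ^ 3 = (B ^ 3) ^ 2 := by ring
        _ ≤ (16 * (s * t)) ^ 2 := Nat.pow_le_pow_left hB16 2
        _ = (256 * s ^ 2) * t ^ 2 := by ring
        _ ≤ t * t ^ 2 := Nat.mul_le_mul_right _ hUt
        _ = t ^ 3 := by ring
    exact (Nat.pow_le_pow_iff_left (by norm_num)).1 h1
  have htB : t * B ≤ p := by
    have h1 : (t * B) ^ 2 ≤ p ^ 2 := by
      calc (t * B) ^ 2 = t ^ 2 * B ^ 2 := by ring
        _ ≤ t ^ 2 * t := Nat.mul_le_mul_left _ hBt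
        _ = t ^ 3 := by ring
        _ ≤ _ := htp
    exact (Nat.pow_le_pow_iff_left (by norm_num)).1 h1
  have hBt' : B ≤ t := le_trans (by nlinarith) hBt
  set D := t / B with hD
  have hD1 : 1 ≤ D := Nat.div_pos hBt' (by omega)
  have hDB : D * B ≤ t := Nat.div_mul_le_self t B
  have hDt : D ≤ t := Nat.div_le_self _ _
  have htD : t < (D + 1) * B := by
    rw [mul_comm]; exact Nat.lt_mul_div_succ t (by omega)
  have hkey : 2 * s * D < B * B := by
    have h1 : (2 * s * D) * B ≤ 2 * s * t := by
      rw [mul_assoc]; exact Nat.mul_le_mul_left _ hDB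
    have h2 : (2 * s * D) * B < (B * B) * B := by
      calc _ ≤ _ := h1
        _ < _ := hB
        _ = _ := by ring
    exact lt_of_mul_lt_mul_right h2 (Nat.zero_le _)
  have := stepanov_core t D B D (by omega) U S hU hDt hDB htB (by nlinarith) (by
    calc #U * D * (D + D) = D * (2 * s * D) := by rw [← hs]; ring
      _ < D * (B * B) := Nat.mul_lt_mul_of_pos_left hkey hD1
      _ = _ := by ring) hS
  have hS4 : #S ≤ 4 * B ^ 2 := by
    have h1 : D * #S ≤ D * (4 * B ^ 2) := by
      calc _ ≤ _ := this
        _ ≤ 2 * ((D + 1) * B) * B := by gcongr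
        _ ≤ 2 * ((D + D) * B) * B := by gcongr
        _ = _ := by ring
    exact Nat.le_of_mul_le_mul_left h1 hD1
  calc #S ^ 3 ≤ (4 * B ^ 2) ^ 3 := Nat.pow_le_pow_left hS4 3
    _ = 64 * (B ^ 3) ^ 2 := by ring
    _ ≤ 64 * (16 * (s * t)) ^ 2 := by gcongr
    _ = _ := by ring

/-- number of `y` with `y^t = (y-1)^t = u`. -/
def cnt (p : ℕ) [Fact p.Prime] (t : ℕ) (u : ZMod p) : ℕ :=
  #((Finset.univ : Finset (ZMod p)).filter (fun y => y ^ t = u ∧ (y - 1) ^ t = u))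

lemma card_roots_le' {p : ℕ} [Fact p.Prime] (t : ℕ) (ht : t ≠ 0) (u : ZMod p) :
    #((Finset.univ : Finset (ZMod p)).filter (fun y => y ^ t = u)) ≤ t := by
  calc _ ≤ #((Polynomial.nthRoots t u).toFinset) := by
        apply Finset.card_le_card
        intro y hy
        rw [Multiset.mem_toFinset, Polynomial.mem_nthRoots (Nat.pos_of_ne_zero ht)]
        simpa using hy
    _ ≤ _ := Multiset.toFinset_card_le _
    _ ≤ t := Polynomial.card_nthRoots t u

lemma cnt_le {p : ℕ} [Fact p.Prime] (t : ℕ) (ht : t ≠ 0) (u : ZMod p) : cnt p t u ≤ t := by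
  refine le_trans (Finset.card_le_card ?_) (card_roots_le' t ht u)
  intro y
  simp only [Finset.mem_filter, Finset.mem_univ, true_and]
  exact fun h => h.1

lemma sum_cnt_eq {p : ℕ} [Fact p.Prime] (t : ℕ) (U : Finset (ZMod p)) :
    ∑ u ∈ U, cnt p t u =
      #((Finset.univ : Finset (ZMod p)).filter (fun y => y ^ t ∈ U ∧ (y - 1) ^ t = y ^ t)) := by
  rw [Finset.card_eq_sum_card_fiberwise (f := fun y => y ^ t) (t := U)]
  · refine Finset.sum_congr rfl fun u hu => ?_
    rw [cnt]
    congr 1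
    ext y
    simp only [Finset.mem_filter, Finset.mem_univ, true_and]
    constructor
    · rintro ⟨h1, h2⟩
      exact ⟨⟨h1 ▸ hu, h2.trans h1.symm⟩, h1⟩
    · rintro ⟨⟨h1, h2⟩, h3⟩
      exact ⟨h3, h2.trans h3⟩
  · intro y hy
    simp only [Finset.coe_filter, Finset.mem_univ, true_and, Set.mem_ofPred_eq] at hy
    exact hy.1

lemma sum_cnt_le {p : ℕ} [Fact p.Prime] (t : ℕ) (ht : t ≠ 0) :
    ∑ u ∈ (Finset.univ : Finset (ZMod p)).erase 0, cnt p t u ≤ t := by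
  rw [sum_cnt_eq]
  refine le_trans ?_ (card_roots_le' (p := p) t ht 1)
  have hy0 : ∀ y : ZMod p, y ^ t ≠ 0 → y ≠ 0 := by
    rintro y h rfl
    exact h (zero_pow ht)
  apply Finset.card_le_card_of_injOn (fun y => (y - 1) / y)
  · intro y hy
    simp only [Finset.coe_filter, Finset.mem_univ, true_and, Set.mem_ofPred_eq, Finset.mem_erase,
      and_true] at hy ⊢
    rw [div_pow, hy.2, div_self hy.1]
  · intro y hy z hz h
    simp only [Finset.coe_filter, Finset.mem_univ, true_and, Set.mem_ofPred_eq, Finset.mem_erase,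
      and_true] at hy hz h
    have h1 := hy0 y hy.1
    have h2 := hy0 z hz.1
    field_simp at h
    linear_combination h

lemma level_aux {p : ℕ} [Fact p.Prime] (t τ : ℕ) (U : Finset (ZMod p))
    (hU : (0 : ZMod p) ∉ U) (hU1 : 1 ≤ #U) (hUt : 256 * #U ^ 2 ≤ t) (htp : t ^ 3 ≤ p ^ 2)
    (hτ : ∀ u ∈ U, τ ≤ cnt p t u) : #U * τ ^ 3 ≤ 16384 * t ^ 2 := by
  have h1 := stepanov_num t U (hU := hU) (hU1 := hU1) (hUt := hUt) (htp := htp)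
    (S := (Finset.univ : Finset (ZMod p)).filter (fun y => y ^ t ∈ U ∧ (y - 1) ^ t = y ^ t))
    (hS := by intro y hy; simpa using hy)
  rw [← sum_cnt_eq] at h1
  have h2 : #U * τ ≤ ∑ u ∈ U, cnt p t u := by
    rw [← smul_eq_mul]; exact Finset.card_nsmul_le_sum _ _ _ hτ
  have h3 : #U ^ 2 * (#U * τ ^ 3) ≤ #U ^ 2 * (16384 * t ^ 2) := by
    calc _ = (#U * τ) ^ 3 := by ring
      _ ≤ (∑ u ∈ U, cnt p t u) ^ 3 := Nat.pow_le_pow_left h2 3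
      _ ≤ _ := h1
      _ = _ := by ring
  exact Nat.le_of_mul_le_mul_left h3 (by positivity)

lemma level_bound {p : ℕ} [Fact p.Prime] (t τ : ℕ) (ht : 256 ≤ t) (htp : t ^ 3 ≤ p ^ 2)
    (hτ : 8192 * t ≤ τ ^ 2) :
    #(((Finset.univ : Finset (ZMod p)).erase 0).filter (fun u => τ ≤ cnt p t u)) * τ ^ 3
      ≤ 16384 * t ^ 2 := by
  set T := ((Finset.univ : Finset (ZMod p)).erase 0).filter (fun u => τ ≤ cnt p t u) with hT
  have hT0 : (0 : ZMod p) ∉ T := by simp [hT]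
  have hTτ : ∀ u ∈ T, τ ≤ cnt p t u := by
    intro u hu; rw [hT, Finset.mem_filter] at hu; exact hu.2
  rcases Nat.eq_zero_or_pos (#T) with h0 | h1
  · rw [h0]; simp
  by_cases hc : 256 * #T ^ 2 ≤ t
  · exact level_aux t τ T hT0 h1 hc htp hTτ
  exfalso
  set s := Nat.sqrt (t / 256) with hs
  have hs1 : 1 ≤ s := by
    rw [hs, Nat.le_sqrt]; omega
  have hs2 : 256 * s ^ 2 ≤ t := by
    have := Nat.sqrt_le' (t / 256)
    rw [← hs] at this
    omega
  have hs3 : t < 256 * (s + 1) ^ 2 := by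
    have := Nat.lt_succ_sqrt' (t / 256)
    rw [← hs] at this
    simp only [Nat.succ_eq_add_one] at this
    omega
  have hsT : s ≤ #T := by
    by_contra hcon
    have : #T ^ 2 ≤ s ^ 2 := Nat.pow_le_pow_left (by omega) 2
    omega
  obtain ⟨U, hUT, hUs⟩ := Finset.exists_subset_card_eq hsT
  have := level_aux t τ U (fun h => hT0 (hUT h)) (by omega) (by rw [hUs]; exact hs2) htp
    (fun u hu => hTτ u (hUT hu))
  rw [hUs] at this
  have ht4 : t ≤ 1024 * s ^ 2 := by nlinarith
  have e1 : t * τ ^ 6 ≤ 2 ^ 38 * t ^ 4 := by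
    calc t * τ ^ 6 ≤ 1024 * s ^ 2 * τ ^ 6 := Nat.mul_le_mul_right _ ht4
      _ = 1024 * (s * τ ^ 3) ^ 2 := by ring
      _ ≤ 1024 * (16384 * t ^ 2) ^ 2 := by gcongr
      _ = _ := by ring
  have e2 : t * (8192 * t) ^ 3 ≤ t * τ ^ 6 := by
    calc t * (8192 * t) ^ 3 ≤ t * (τ ^ 2) ^ 3 := by gcongr
      _ = _ := by ring
  have e3 : 0 < t ^ 4 := by positivity
  have e4 : t * (8192 * t) ^ 3 = 2 ^ 39 * t ^ 4 := by ring
  omega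

lemma sq_le_aux (N M t : ℕ) (hN : N ≤ t) :
    N ^ 2 ≤ M * N + ∑ τ ∈ Finset.Ioc M t, (if τ ≤ N then 2 * τ else 0) := by
  rcases le_or_gt N M with h | h
  · have : N * N ≤ M * N := Nat.mul_le_mul_right _ h
    rw [pow_two]
    exact this.trans (Nat.le_add_right _ _)
  · have h1 : ∀ k, M ≤ k → k ^ 2 ≤ M ^ 2 + ∑ τ ∈ Finset.Ioc M k, 2 * τ := by
      intro k hk
      induction k, hk using Nat.le_induction with
      | base => simp
      | succ k hk ih =>
        rw [Finset.sum_Ioc_succ_top hk]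
        nlinarith
    have h2 : ∑ τ ∈ Finset.Ioc M N, 2 * τ ≤
        ∑ τ ∈ Finset.Ioc M t, (if τ ≤ N then 2 * τ else 0) := by
      rw [← Finset.sum_filter]
      apply Finset.sum_le_sum_of_subset
      intro τ
      simp only [Finset.mem_Ioc, Finset.mem_filter]
      omega
    have := h1 N h.le
    nlinarith

lemma sum_cnt_sq {p : ℕ} [Fact p.Prime] (t : ℕ) (ht : 256 ≤ t) (htp : t ^ 3 ≤ p ^ 2) :
    (∑ u ∈ (Finset.univ : Finset (ZMod p)).erase 0, (cnt p t u : ℝ) ^ 2) ≤ 600 * t * √t := by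
  set M := Nat.sqrt (8192 * t) + 1 with hM
  have hM1 : 8192 * t ≤ M ^ 2 := (Nat.lt_succ_sqrt' (8192 * t)).le
  have hM2 : (M - 1) ^ 2 ≤ 8192 * t := Nat.sqrt_le' (8192 * t)
  have ht0 : (0 : ℝ) < t := by positivity
  set r : ℝ := √t with hr
  have hr0 : 0 < r := Real.sqrt_pos.2 ht0
  have hrr : r ^ 2 = t := Real.sq_sqrt ht0.le
  have hr16 : 16 ≤ r := by
    rw [hr]; apply Real.le_sqrt_of_sq_le
    have : (256 : ℝ) ≤ t := by exact_mod_cast ht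
    linarith
  have hMr1 : 90 * r ≤ M := by
    apply le_of_sq_le_sq _ (by positivity)
    have : (8192 * t : ℝ) ≤ M ^ 2 := by exact_mod_cast hM1
    nlinarith
  have hMr2 : (M : ℝ) ≤ 92 * r := by
    have h1 : ((M - 1 : ℕ) : ℝ) ≤ 91 * r := by
      apply le_of_sq_le_sq _ (by positivity)
      have : ((M - 1 : ℕ) : ℝ) ^ 2 ≤ 8192 * t := by exact_mod_cast hM2
      nlinarith
    have h2 : (M : ℝ) = ((M - 1 : ℕ) : ℝ) + 1 := by
      rw [hM]; push_cast; simp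
    linarith
  have hM0 : (0 : ℝ) < M := by linarith
  set W := (Finset.univ : Finset (ZMod p)).erase 0 with hW
  have step1 : ∑ u ∈ W, (cnt p t u) ^ 2 ≤
      M * t + ∑ τ ∈ Finset.Ioc M t, 2 * τ * #(W.filter (fun u => τ ≤ cnt p t u)) := by
    calc ∑ u ∈ W, (cnt p t u) ^ 2 ≤ ∑ u ∈ W, (M * cnt p t u +
          ∑ τ ∈ Finset.Ioc M t, (if τ ≤ cnt p t u then 2 * τ else 0)) :=
          Finset.sum_le_sum fun u _ => sq_le_aux _ _ _ (cnt_le t (by omega) u)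
      _ = M * ∑ u ∈ W, cnt p t u + ∑ τ ∈ Finset.Ioc M t, ∑ u ∈ W,
          (if τ ≤ cnt p t u then 2 * τ else 0) := by
          rw [Finset.sum_add_distrib, Finset.mul_sum, Finset.sum_comm]
      _ ≤ _ := by
          refine Nat.add_le_add (Nat.mul_le_mul_left _ (sum_cnt_le t (by omega))) ?_
          refine Finset.sum_le_sum fun τ _ => ?_
          rw [← Finset.sum_filter, Finset.sum_const, smul_eq_mul, mul_comm]
  have step2 : (∑ τ ∈ Finset.Ioc M t, (2 * τ * #(W.filter (fun u => τ ≤ cnt p t u)) : ℝ)) ≤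
      32768 * t ^ 2 * (1 / M) := by
    calc _ ≤ ∑ τ ∈ Finset.Ioc M t, 32768 * (t : ℝ) ^ 2 * ((τ : ℝ) ^ 2)⁻¹ := by
          refine Finset.sum_le_sum fun τ hτ => ?_
          rw [Finset.mem_Ioc] at hτ
          have hb := level_bound (p := p) t τ ht htp (hM1.trans (Nat.pow_le_pow_left hτ.1.le 2))
          have hb' : (#(W.filter (fun u => τ ≤ cnt p t u)) : ℝ) * τ ^ 3 ≤ 16384 * t ^ 2 := by
            exact_mod_cast hb
          have hτ0 : (0 : ℝ) < τ := by
            have : 0 < τ := by omega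
            exact_mod_cast this
          rw [← div_eq_mul_inv, le_div_iff₀ (by positivity)]
          nlinarith
      _ = 32768 * t ^ 2 * ∑ τ ∈ Finset.Ioc M t, ((τ : ℝ) ^ 2)⁻¹ := by rw [Finset.mul_sum]
      _ ≤ _ := by
          gcongr
          rcases le_or_gt M t with h | h
          · have := sum_Ioc_inv_sq_le_sub (α := ℝ) (k := M) (n := t) (by omega) h
            have h2 : (0 : ℝ) ≤ (t : ℝ)⁻¹ := by positivity
            rw [one_div]
            linarith
          · rw [Finset.Ioc_eq_empty (by omega)]
            simp
  have step1' : (∑ u ∈ W, (cnt p t u : ℝ) ^ 2) ≤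
      M * t + ∑ τ ∈ Finset.Ioc M t, (2 * τ * #(W.filter (fun u => τ ≤ cnt p t u)) : ℝ) := by
    exact_mod_cast step1
  have step3 : 32768 * (t : ℝ) ^ 2 * (1 / M) ≤ 370 * t * r := by
    rw [mul_one_div, div_le_iff₀ hM0]
    have : 370 * (t : ℝ) * r * (90 * r) ≤ 370 * t * r * M := by gcongr
    have e : 370 * (t : ℝ) * r * (90 * r) = 33300 * t ^ 2 := by rw [← hrr]; ring
    nlinarith
  have step4 : (M : ℝ) * t ≤ 92 * r * t := by gcongr
  have : 0 < (t : ℝ) * r := by positivity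
  linarith

/-- number of representations `a = x - y` with `x, y ∈ R`. -/
def dcnt {p : ℕ} (R : Finset (ZMod p)) (a : ZMod p) : ℕ := #(R.filter (fun x => x - a ∈ R))

/-- exponential sum over `R`. -/
noncomputable def eSum {p : ℕ} [Fact p.Prime] (R : Finset (ZMod p)) (ξ : ZMod p) : ℂ :=
  ∑ r ∈ R, ZMod.stdAddChar (ξ * r)

lemma conj_std {p : ℕ} [Fact p.Prime] (x : ZMod p) :
    (starRingEnd ℂ) (ZMod.stdAddChar x) = ZMod.stdAddChar (-x) :=
  (AddChar.map_neg_eq_conj _ _).symm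

lemma std_orth {p : ℕ} [Fact p.Prime] (b : ZMod p) :
    ∑ ξ : ZMod p, ZMod.stdAddChar (ξ * b) = if b = 0 then (p : ℂ) else 0 := by
  have := AddChar.sum_mulShift b (ZMod.isPrimitive_stdAddChar p)
  rw [this]
  simp [ZMod.card]

lemma parseval_real {p : ℕ} [Fact p.Prime] (f : ZMod p → ℝ) :
    ∑ ξ : ZMod p, ‖∑ v, (f v : ℂ) * ZMod.stdAddChar (ξ * v)‖ ^ 2 = p * ∑ v, f v ^ 2 := by
  have h : ((∑ ξ : ZMod p, ‖∑ v, (f v : ℂ) * ZMod.stdAddChar (ξ * v)‖ ^ 2 : ℝ) : ℂ)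
      = ((p * ∑ v, f v ^ 2 : ℝ) : ℂ) := by
    push_cast
    calc ∑ ξ : ZMod p, (‖∑ v, (f v : ℂ) * ZMod.stdAddChar (ξ * v)‖ : ℂ) ^ 2
        = ∑ ξ : ZMod p, ∑ v, ∑ w, (f v : ℂ) * f w * ZMod.stdAddChar (ξ * (v - w)) := by
          refine Finset.sum_congr rfl fun ξ _ => ?_
          rw [← Complex.mul_conj', map_sum, Finset.sum_mul_sum]
          refine Finset.sum_congr rfl fun v _ => Finset.sum_congr rfl fun w _ => ?_
          rw [map_mul (starRingEnd ℂ), conj_std, Complex.conj_ofReal, mul_sub, sub_eq_add_neg,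
            AddChar.map_add_eq_mul]
          ring
      _ = ∑ v, ∑ w, (f v : ℂ) * f w * ∑ ξ : ZMod p, ZMod.stdAddChar (ξ * (v - w)) := by
          rw [Finset.sum_comm]
          refine Finset.sum_congr rfl fun v _ => ?_
          rw [Finset.sum_comm]
          refine Finset.sum_congr rfl fun w _ => ?_
          rw [Finset.mul_sum]
      _ = ∑ v, (f v : ℂ) * f v * p := by
          refine Finset.sum_congr rfl fun v _ => ?_
          rw [Finset.sum_eq_single v]
          · rw [std_orth]; simp
          · intro w _ hw
            rw [std_orth, if_neg (sub_ne_zero.2 hw.symm), mul_zero]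
          · simp
      _ = _ := by
          rw [Finset.mul_sum]
          refine Finset.sum_congr rfl fun v _ => ?_
          ring
  exact_mod_cast h

lemma eSum_l2 {p : ℕ} [Fact p.Prime] (R : Finset (ZMod p)) :
    ∑ ξ, ‖eSum R ξ‖ ^ 2 = p * #R := by
  have := parseval_real (p := p) (fun v => if v ∈ R then 1 else 0)
  have e : ∀ ξ : ZMod p, ∑ v, (((if v ∈ R then 1 else 0 : ℝ)) : ℂ) * ZMod.stdAddChar (ξ * v)
      = eSum R ξ := by
    intro ξ
    rw [eSum, ← Finset.sum_filter_add_sum_filter_not Finset.univ (fun v => v ∈ R)]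
    rw [Finset.sum_congr rfl (g := fun v => ZMod.stdAddChar (ξ * v))]
    · rw [Finset.sum_eq_zero (s := Finset.univ.filter (fun v => ¬ v ∈ R))]
      · simp
      · intro v hv
        simp only [Finset.mem_filter, Finset.mem_univ, true_and] at hv
        simp [hv]
    · intro v hv
      simp only [Finset.mem_filter, Finset.mem_univ, true_and] at hv
      simp [hv]
  simp only [e] at this
  rw [this]
  simp

lemma sum_diff {p : ℕ} [Fact p.Prime] {M : Type*} [Semiring M] (R : Finset (ZMod p))
    (g : ZMod p → M) :
    ∑ x ∈ R, ∑ y ∈ R, g (x - y) = ∑ v, (dcnt R v : M) * g v := by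
  have h1 : ∀ x ∈ R, ∑ y ∈ R, g (x - y) = ∑ v, if x - v ∈ R then g v else 0 := by
    intro x _
    rw [← Equiv.sum_comp (Equiv.subLeft x) (fun v => if x - v ∈ R then g v else 0)]
    simp
  rw [Finset.sum_congr rfl h1, Finset.sum_comm]
  refine Finset.sum_congr rfl fun v _ => ?_
  rw [← Finset.sum_filter, Finset.sum_const, dcnt, nsmul_eq_mul]

lemma eSum_sq {p : ℕ} [Fact p.Prime] (R : Finset (ZMod p)) (ξ : ZMod p) :
    ((‖eSum R ξ‖ ^ 2 : ℝ) : ℂ) = ∑ v, (dcnt R v : ℂ) * ZMod.stdAddChar (ξ * v) := by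
  rw [← sum_diff R (fun v => (ZMod.stdAddChar (ξ * v) : ℂ))]
  push_cast
  rw [← Complex.mul_conj', eSum, map_sum, Finset.sum_mul_sum]
  refine Finset.sum_congr rfl fun v _ => Finset.sum_congr rfl fun w _ => ?_
  rw [conj_std, mul_sub, sub_eq_add_neg, AddChar.map_add_eq_mul]

lemma eSum_l4 {p : ℕ} [Fact p.Prime] (R : Finset (ZMod p)) :
    ∑ ξ, ‖eSum R ξ‖ ^ 4 = p * ∑ v, (dcnt R v : ℝ) ^ 2 := by
  rw [← parseval_real]
  refine Finset.sum_congr rfl fun ξ _ => ?_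
  have := eSum_sq R ξ
  have h2 := congrArg norm this
  rw [Complex.norm_real, Real.norm_of_nonneg (by positivity)] at h2
  simp only [Complex.ofReal_natCast]
  rw [← h2]
  ring

lemma eSum_inv {p : ℕ} [Fact p.Prime] {R : Finset (ZMod p)} {t : ℕ} (ht : t ≠ 0)
    (hR : ∀ x, x ∈ R ↔ x ^ t = 1) (ξ r : ZMod p) (hr : r ∈ R) :
    eSum R (ξ * r) = eSum R ξ := by
  have hr1 := (hR r).1 hr
  have hr0 : r ≠ 0 := by rintro rfl; rw [zero_pow ht] at hr1; exact zero_ne_one hr1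
  refine Finset.sum_nbij' (fun x => r * x) (fun x => r⁻¹ * x) ?_ ?_ ?_ ?_ ?_
  · intro x hx; rw [hR] at hx ⊢; rw [mul_pow, hx, hr1, mul_one]
  · intro x hx; rw [hR] at hx ⊢; rw [mul_pow, hx, inv_pow, hr1]; simp
  · intro x _; field_simp
  · intro x _; field_simp
  · intro x _; rw [mul_assoc]

lemma sum_mul_le {p : ℕ} [Fact p.Prime] (R : Finset (ZMod p)) (ξ : ZMod p) (hξ : ξ ≠ 0)
    (F : ZMod p → ℝ) (hF : ∀ x, 0 ≤ F x) : ∑ r ∈ R, F (ξ * r) ≤ ∑ x, F x := by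
  rw [← Equiv.sum_comp (Equiv.mulLeft₀ ξ hξ) F]
  exact Finset.sum_le_sum_of_subset_of_nonneg (Finset.subset_univ _) (fun _ _ _ => hF _)

lemma eSum_max {p : ℕ} [Fact p.Prime] {R : Finset (ZMod p)} {t : ℕ} (ht : t ≠ 0)
    (hR : ∀ x, x ∈ R ↔ x ^ t = 1) (ξ : ZMod p) (hξ : ξ ≠ 0) (n : ℕ) :
    #R * ‖eSum R ξ‖ ^ n ≤ ∑ η, ‖eSum R η‖ ^ n := by
  have := sum_mul_le R ξ hξ (fun x => ‖eSum R x‖ ^ n) (fun _ => by positivity)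
  rw [Finset.sum_congr rfl (g := fun _ => ‖eSum R ξ‖ ^ n)
    (fun r hr => by rw [eSum_inv ht hR ξ r hr])] at this
  simpa using this

lemma eSum_eight {p : ℕ} [Fact p.Prime] {R : Finset (ZMod p)} {t : ℕ} (ht : t ≠ 0)
    (hR : ∀ x, x ∈ R ↔ x ^ t = 1) (ξ : ZMod p) (hξ : ξ ≠ 0) :
    ‖eSum R ξ‖ ^ 8 ≤ p * (∑ v, (dcnt R v : ℝ) ^ 2) ^ 2 := by
  have h1R : (1 : ZMod p) ∈ R := by rw [hR]; simp
  have hcard : (0 : ℝ) < #R := by exact_mod_cast Finset.card_pos.2 ⟨1, h1R⟩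
  have e1 : ((#R * ‖eSum R ξ‖ ^ 2 : ℝ) : ℂ) = ∑ x ∈ R, ∑ y ∈ R, eSum R (ξ * (x - y)) := by
    rw [sum_diff R (fun v => eSum R (ξ * v))]
    have : ((#R * ‖eSum R ξ‖ ^ 2 : ℝ) : ℂ) = ∑ r ∈ R, ((‖eSum R (ξ * r)‖ ^ 2 : ℝ) : ℂ) := by
      rw [Finset.sum_congr rfl (g := fun _ => ((‖eSum R ξ‖ ^ 2 : ℝ) : ℂ))
        (fun r hr => by rw [eSum_inv ht hR ξ r hr])]
      simp
    rw [this]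
    simp only [eSum_sq]
    rw [Finset.sum_comm]
    refine Finset.sum_congr rfl fun v _ => ?_
    rw [← Finset.mul_sum, eSum]
    congr 1
    refine Finset.sum_congr rfl fun r _ => ?_
    congr 1; ring
  have e2 : #R * ‖eSum R ξ‖ ^ 2 ≤ ∑ q ∈ R ×ˢ R, ‖eSum R (ξ * (q.1 - q.2))‖ := by
    have h := congrArg norm e1
    rw [Complex.norm_real, Real.norm_of_nonneg (by positivity)] at h
    rw [h, ← Finset.sum_product']
    exact norm_sum_le _ _
  have e3 : ‖eSum R ξ‖ ^ 4 ≤ ∑ v, (dcnt R v : ℝ) * ‖eSum R (ξ * v)‖ ^ 2 := by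
    have h1 := sq_sum_le_card_mul_sum_sq (s := R ×ˢ R)
      (f := fun q => ‖eSum R (ξ * (q.1 - q.2))‖)
    rw [Finset.sum_product' R R (fun x y => ‖eSum R (ξ * (x - y))‖ ^ 2),
      sum_diff R (fun v => ‖eSum R (ξ * v)‖ ^ 2), Finset.card_product] at h1
    have h2 := pow_le_pow_left₀ (by positivity) e2 2
    have h3 := h2.trans h1
    push_cast at h3
    have h4 : ((#R : ℝ) * #R) * ‖eSum R ξ‖ ^ 4 ≤ (#R * #R) *
      ∑ v, (dcnt R v : ℝ) * ‖eSum R (ξ * v)‖ ^ 2 := by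
      refine le_trans (le_of_eq ?_) h3
      ring
    exact le_of_mul_le_mul_left h4 (by positivity)
  have e4 := Finset.sum_mul_sq_le_sq_mul_sq Finset.univ (fun v => (dcnt R v : ℝ))
    (fun v => ‖eSum R (ξ * v)‖ ^ 2)
  have e5 : ∑ v, (‖eSum R (ξ * v)‖ ^ 2) ^ 2 = p * ∑ v, (dcnt R v : ℝ) ^ 2 := by
    rw [← eSum_l4, ← Equiv.sum_comp (Equiv.mulLeft₀ ξ hξ) (fun v => ‖eSum R v‖ ^ 4)]
    refine Finset.sum_congr rfl fun v _ => ?_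
    change (‖eSum R (ξ * v)‖ ^ 2) ^ 2 = ‖eSum R (ξ * v)‖ ^ 4
    ring
  rw [e5] at e4
  have e6 := pow_le_pow_left₀ (by positivity) e3 2
  calc ‖eSum R ξ‖ ^ 8 = (‖eSum R ξ‖ ^ 4) ^ 2 := by ring
    _ ≤ _ := e6
    _ ≤ _ := e4
    _ = _ := by ring

lemma map_sum_aux {p : ℕ} [Fact p.Prime] {l : ℕ} (s : Finset (Fin l)) (f : Fin l → ZMod p) :
    (ZMod.stdAddChar (∑ i ∈ s, f i) : ℂ) = ∏ i ∈ s, (ZMod.stdAddChar (f i) : ℂ) := by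
  induction s using Finset.cons_induction with
  | empty => simp
  | cons i s hi ih => rw [Finset.sum_cons, Finset.prod_cons, AddChar.map_add_eq_mul, ih]

lemma eSum_count {p : ℕ} [Fact p.Prime] {R : Finset (ZMod p)} {t : ℕ} (ht : t ≠ 0)
    (hR : ∀ x, x ∈ R ↔ x ^ t = 1) (a : ZMod p) (l : ℕ)
    (hno : ¬ ∃ r : Fin l → ZMod p, (∀ i, r i ∈ R) ∧ ∑ i, r i = a) :
    (#R : ℝ) ^ (l + 1) ≤ ∑ ξ ∈ Finset.univ.erase 0, ‖eSum R ξ‖ ^ l * ‖eSum R (-a * ξ)‖ := by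
  have hzero : ∑ ξ, eSum R ξ ^ l * eSum R (-a * ξ) = 0 := by
    have h1 : ∀ ξ, eSum R ξ ^ l * eSum R (-a * ξ) =
        ∑ r ∈ Fintype.piFinset (fun _ : Fin l => R), ∑ q ∈ R,
          ZMod.stdAddChar (ξ * (∑ i, r i - a * q)) := by
      intro ξ
      have : eSum R ξ ^ l = ∑ r ∈ Fintype.piFinset (fun _ : Fin l => R),
          ZMod.stdAddChar (ξ * ∑ i, r i) := by
        have h := Finset.prod_univ_sum (fun _ : Fin l => R)
          (fun _ x => (ZMod.stdAddChar (ξ * x) : ℂ))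
        rw [Finset.prod_const, Finset.card_univ, Fintype.card_fin] at h
        rw [eSum, h]
        refine Finset.sum_congr rfl fun r _ => ?_
        rw [Finset.mul_sum]
        exact (map_sum_aux _ _).symm
      rw [this, eSum, Finset.sum_mul_sum]
      refine Finset.sum_congr rfl fun r _ => Finset.sum_congr rfl fun q _ => ?_
      rw [← AddChar.map_add_eq_mul]
      congr 1; ring
    simp only [h1]
    rw [Finset.sum_comm]
    refine Finset.sum_eq_zero fun r hr => ?_
    rw [Finset.sum_comm]
    refine Finset.sum_eq_zero fun q hq => ?_
    rw [std_orth, if_neg]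
    intro h
    apply hno
    have hq1 := (hR q).1 hq
    have hq0 : q ≠ 0 := by rintro rfl; rw [zero_pow ht] at hq1; exact zero_ne_one hq1
    refine ⟨fun i => r i * q⁻¹, fun i => ?_, ?_⟩
    · have := (hR _).1 (Fintype.mem_piFinset.1 hr i)
      rw [hR, mul_pow, this, inv_pow, hq1]; simp
    · rw [← Finset.sum_mul, sub_eq_zero.1 h, mul_assoc, mul_inv_cancel₀ hq0, mul_one]
  rw [← Finset.add_sum_erase _ _ (Finset.mem_univ (0 : ZMod p))] at hzero
  have h0 : eSum R 0 = (#R : ℂ) := by simp [eSum]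
  rw [mul_zero, h0, ← pow_succ] at hzero
  have h2 := congrArg norm (eq_neg_of_add_eq_zero_left hzero)
  rw [norm_neg, norm_pow, Complex.norm_natCast] at h2
  rw [h2]
  refine (norm_sum_le _ _).trans (le_of_eq ?_)
  refine Finset.sum_congr rfl fun ξ _ => ?_
  rw [norm_mul, norm_pow]

lemma analytic_package {p : ℕ} [Fact p.Prime] {R : Finset (ZMod p)} {t : ℕ} (ht : t ≠ 0)
    (hR : ∀ x, x ∈ R ↔ x ^ t = 1) (hRt : #R = t) (a : ZMod p) (ha : a ≠ 0) (k : ℕ) (E : ℝ)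
    (hE : E = ∑ v, (dcnt R v : ℝ) ^ 2)
    (hno : ¬ ∃ r : Fin (k + 3) → ZMod p, (∀ i, r i ∈ R) ∧ ∑ i, r i = a) :
    ∃ m : ℝ, 0 ≤ m ∧ t * m ^ 4 ≤ p * E ∧ m ^ 8 ≤ p * E ^ 2 ∧ m ^ 2 ≤ p ∧
      (t : ℝ) ^ (k + 4) ≤ m ^ k * (p * E) ∧ (t : ℝ) ^ (k + 4) ≤ m ^ (k + 2) * (p * t) := by
  obtain ⟨ξ₀, hξ₀, hmax⟩ := Finset.exists_max_image ((Finset.univ : Finset (ZMod p)).erase 0)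
    (fun ξ => ‖eSum R ξ‖) ⟨1, by simp⟩
  have hξ : ξ₀ ≠ 0 := (Finset.mem_erase.1 hξ₀).1
  have htpos : (0 : ℝ) < t := by exact_mod_cast Nat.pos_of_ne_zero ht
  have hcount := eSum_count ht hR a (k + 3) hno
  rw [hRt] at hcount
  have hna : -a ≠ 0 := neg_ne_zero.2 ha
  set m := ‖eSum R ξ₀‖ with hm
  have hm0 : 0 ≤ m := norm_nonneg _
  have hshift : ∀ n, ∑ ξ, ‖eSum R (-a * ξ)‖ ^ n = ∑ ξ, ‖eSum R ξ‖ ^ n := fun n =>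
    Equiv.sum_comp (Equiv.mulLeft₀ (-a) hna) (fun ξ => ‖eSum R ξ‖ ^ n)
  have h4 := eSum_l4 R
  rw [← hE] at h4
  have h2 := eSum_l2 R
  rw [hRt] at h2
  refine ⟨m, hm0, ?_, ?_, ?_, ?_, ?_⟩
  · have := eSum_max ht hR ξ₀ hξ 4
    rwa [hRt, h4] at this
  · have := eSum_eight ht hR ξ₀ hξ
    rwa [← hE] at this
  · have := eSum_max ht hR ξ₀ hξ 2
    rw [hRt, h2, mul_comm (p : ℝ)] at this
    exact le_of_mul_le_mul_left this htpos
  · refine hcount.trans ?_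
    calc _ ≤ ∑ ξ ∈ Finset.univ.erase 0, m ^ k *
          (3 / 4 * ‖eSum R ξ‖ ^ 4 + 1 / 4 * ‖eSum R (-a * ξ)‖ ^ 4) := by
          refine Finset.sum_le_sum fun ξ hx => ?_
          have hb := hmax ξ hx
          set x := ‖eSum R ξ‖ with hxdef
          set y := ‖eSum R (-a * ξ)‖ with hydef
          have hx0 : 0 ≤ x := norm_nonneg _
          have hy0 : 0 ≤ y := norm_nonneg _
          have hamgm : x ^ 3 * y ≤ 3 / 4 * x ^ 4 + 1 / 4 * y ^ 4 := by
            have : 0 ≤ (x - y) ^ 2 * (3 * x ^ 2 + 2 * x * y + y ^ 2) := by positivity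
            nlinarith
          calc x ^ (k + 3) * y = x ^ k * (x ^ 3 * y) := by ring
            _ ≤ m ^ k * (x ^ 3 * y) := by gcongr
            _ ≤ _ := by gcongr
      _ ≤ ∑ ξ, m ^ k * (3 / 4 * ‖eSum R ξ‖ ^ 4 + 1 / 4 * ‖eSum R (-a * ξ)‖ ^ 4) :=
          Finset.sum_le_sum_of_subset_of_nonneg (Finset.subset_univ _)
            (fun _ _ _ => by positivity)
      _ = _ := by
          rw [← Finset.mul_sum, Finset.sum_add_distrib, ← Finset.mul_sum, ← Finset.mul_sum,
            hshift 4, h4]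
          ring
  · refine hcount.trans ?_
    calc _ ≤ ∑ ξ ∈ Finset.univ.erase 0, m ^ (k + 2) *
          (1 / 2 * ‖eSum R ξ‖ ^ 2 + 1 / 2 * ‖eSum R (-a * ξ)‖ ^ 2) := by
          refine Finset.sum_le_sum fun ξ hx => ?_
          have hb := hmax ξ hx
          set x := ‖eSum R ξ‖ with hxdef
          set y := ‖eSum R (-a * ξ)‖ with hydef
          have hx0 : 0 ≤ x := norm_nonneg _
          have hy0 : 0 ≤ y := norm_nonneg _
          have hamgm : x * y ≤ 1 / 2 * x ^ 2 + 1 / 2 * y ^ 2 := by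
            nlinarith [sq_nonneg (x - y)]
          calc x ^ (k + 3) * y = x ^ (k + 2) * (x * y) := by ring
            _ ≤ m ^ (k + 2) * (x * y) := by gcongr
            _ ≤ _ := by gcongr
      _ ≤ ∑ ξ, m ^ (k + 2) * (1 / 2 * ‖eSum R ξ‖ ^ 2 + 1 / 2 * ‖eSum R (-a * ξ)‖ ^ 2) :=
          Finset.sum_le_sum_of_subset_of_nonneg (Finset.subset_univ _)
            (fun _ _ _ => by positivity)
      _ = _ := by
          rw [← Finset.mul_sum, Finset.sum_add_distrib, ← Finset.mul_sum, ← Finset.mul_sum,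
            hshift 2, h2]
          ring

lemma dcnt_le {p : ℕ} (R : Finset (ZMod p)) (a : ZMod p) : dcnt R a ≤ #R :=
  Finset.card_filter_le _ _

lemma sum_dcnt {p : ℕ} [Fact p.Prime] (R : Finset (ZMod p)) : ∑ v, dcnt R v = #R ^ 2 := by
  have := sum_diff R (fun _ => (1 : ℕ))
  simp only [Finset.sum_const, smul_eq_mul, mul_one, Nat.cast_id] at this
  rw [← this, pow_two]

lemma dcnt_eq {p : ℕ} [Fact p.Prime] {R : Finset (ZMod p)} {t : ℕ}
    (hR : ∀ x, x ∈ R ↔ x ^ t = 1) (a : ZMod p) (ha : a ≠ 0) :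
    dcnt R a = cnt p t (a⁻¹ ^ t) := by
  have hat : a ^ t ≠ 0 := pow_ne_zero _ ha
  refine Finset.card_nbij' (fun x => x * a⁻¹) (fun y => y * a) ?_ ?_ ?_ ?_
  · intro x hx
    simp only [Finset.coe_filter, Finset.mem_univ, true_and, Set.mem_ofPred_eq, hR] at hx ⊢
    refine ⟨by rw [mul_pow, hx.1, one_mul], ?_⟩
    have : x * a⁻¹ - 1 = (x - a) * a⁻¹ := by field_simp
    rw [this, mul_pow, hx.2, one_mul]
  · intro y hy
    simp only [Finset.coe_filter, Finset.mem_univ, true_and, Set.mem_ofPred_eq, hR] at hy ⊢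
    refine ⟨by rw [mul_pow, hy.1, inv_pow, inv_mul_cancel₀ hat], ?_⟩
    have : y * a - a = (y - 1) * a := by ring
    rw [this, mul_pow, hy.2, inv_pow, inv_mul_cancel₀ hat]
  · intro x _
    simp only
    field_simp
  · intro y _
    simp only
    field_simp

lemma energy_bound {p : ℕ} [Fact p.Prime] {R : Finset (ZMod p)} {t : ℕ} (ht : t ≠ 0)
    (hR : ∀ x, x ∈ R ↔ x ^ t = 1) (hRt : #R = t) (htp : t ^ 3 ≤ p ^ 2) :
    ∑ v, (dcnt R v : ℝ) ^ 2 ≤ 601 * t ^ 2 * √t := by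
  have ht1 : (1 : ℝ) ≤ t := by exact_mod_cast Nat.one_le_iff_ne_zero.2 ht
  have hr1 : 1 ≤ √(t : ℝ) := Real.one_le_sqrt.2 ht1
  have hrr : √(t : ℝ) ^ 2 = t := Real.sq_sqrt (by linarith)
  rcases lt_or_ge t 256 with hsm | hlg
  · have h1 : ∑ v, (dcnt R v : ℝ) ^ 2 ≤ ∑ v, (t : ℝ) * dcnt R v := by
      refine Finset.sum_le_sum fun v _ => ?_
      rw [pow_two]
      gcongr
      rw [← hRt]
      exact_mod_cast dcnt_le R v
    have h2 : (∑ v, (dcnt R v : ℝ)) = t ^ 2 := by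
      have := sum_dcnt R
      rw [hRt] at this
      exact_mod_cast this
    rw [← Finset.mul_sum, h2] at h1
    have h3 : √(t : ℝ) ≤ 16 := by
      rw [Real.sqrt_le_left (by norm_num)]
      have : (t : ℝ) < 256 := by exact_mod_cast hsm
      linarith
    have h4 : (t : ℝ) ≤ 16 * √t := by nlinarith
    have h5 : (t : ℝ) * t ^ 2 ≤ (16 * √t) * t ^ 2 := by gcongr
    have : 0 ≤ (t : ℝ) ^ 2 * √t := by positivity
    linarith
  · rw [← Finset.add_sum_erase _ _ (Finset.mem_univ (0 : ZMod p))]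
    have h0 : (dcnt R 0 : ℝ) ^ 2 ≤ (t : ℝ) ^ 2 := by
      gcongr
      rw [← hRt]
      exact_mod_cast dcnt_le R 0
    have h1 : ∑ a ∈ Finset.univ.erase 0, (dcnt R a : ℝ) ^ 2 ≤
        t * ∑ u ∈ (Finset.univ : Finset (ZMod p)).erase 0, (cnt p t u : ℝ) ^ 2 := by
      have hmap : ∀ a ∈ (Finset.univ : Finset (ZMod p)).erase 0,
          a⁻¹ ^ t ∈ (Finset.univ : Finset (ZMod p)).erase 0 := by
        intro a ha
        simp only [Finset.mem_erase, Finset.mem_univ, and_true] at ha ⊢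
        exact pow_ne_zero _ (inv_ne_zero ha)
      rw [← Finset.sum_fiberwise_of_maps_to hmap, Finset.mul_sum]
      refine Finset.sum_le_sum fun u _ => ?_
      rw [Finset.sum_congr rfl (g := fun _ => (cnt p t u : ℝ) ^ 2)]
      · rw [Finset.sum_const, nsmul_eq_mul]
        gcongr
        refine le_trans ?_ (card_roots_le' (p := p) t ht u)
        apply Finset.card_le_card_of_injOn (fun a => a⁻¹)
        · intro a ha
          simp only [Finset.coe_filter, Set.mem_ofPred_eq, Finset.mem_univ, true_and] at ha ⊢
          exact ha.2
        · intro a _ b _ h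
          exact inv_injective h
      · intro a ha
        simp only [Finset.mem_filter, Finset.mem_erase, Finset.mem_univ, and_true] at ha
        rw [dcnt_eq hR a ha.1, ha.2]
    have h2 := sum_cnt_sq (p := p) t hlg htp
    have h3 : (t : ℝ) * ∑ u ∈ (Finset.univ : Finset (ZMod p)).erase 0, (cnt p t u : ℝ) ^ 2
      ≤ t * (600 * t * √t) := by gcongr
    have h4 : (t : ℝ) ^ 2 * 1 ≤ t ^ 2 * √t := by gcongr
    linarith

lemma numeric_large (p t m : ℝ) (k : ℕ) (hp : 1 ≤ p) (ht : 0 < t) (hm : 0 ≤ m)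
    (h2 : m ^ 2 ≤ p) (h : t ^ (k + 4) ≤ m ^ (k + 2) * (p * t)) : t ^ 3 ≤ p ^ 2 := by
  by_contra hcon
  push Not at hcon
  have h1 : t ^ (k + 3) ≤ m ^ (k + 2) * p := by
    have : t ^ (k + 3) * t ≤ (m ^ (k + 2) * p) * t := by
      calc _ = t ^ (k + 4) := by ring
        _ ≤ _ := h
        _ = _ := by ring
    exact le_of_mul_le_mul_right this ht
  have h3 : t ^ (2 * (k + 3)) ≤ p ^ (k + 4) := by
    calc t ^ (2 * (k + 3)) = (t ^ (k + 3)) ^ 2 := by ring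
      _ ≤ (m ^ (k + 2) * p) ^ 2 := by gcongr
      _ = (m ^ 2) ^ (k + 2) * p ^ 2 := by ring
      _ ≤ p ^ (k + 2) * p ^ 2 := by gcongr
      _ = _ := by ring
  have h4 : (p ^ 2) ^ (2 * (k + 3)) < (t ^ 3) ^ (2 * (k + 3)) :=
    pow_lt_pow_left₀ hcon (by positivity) (by omega)
  have h5 : (t ^ 3) ^ (2 * (k + 3)) ≤ p ^ (3 * (k + 4)) := by
    calc _ = (t ^ (2 * (k + 3))) ^ 3 := by ring
      _ ≤ (p ^ (k + 4)) ^ 3 := by gcongr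
      _ = _ := by ring
  have h6 : p ^ (3 * (k + 4)) ≤ (p ^ 2) ^ (2 * (k + 3)) := by
    rw [← pow_mul]
    exact pow_le_pow_right₀ hp (by omega)
  linarith

lemma numeric_one (p t m E r K : ℝ) (k : ℕ) (hp : 1 ≤ p) (ht : 0 < t) (hm : 0 ≤ m)
    (hE0 : 0 ≤ E) (hrr : r ^ 2 = t) (hE : E ≤ K * t ^ 2 * r)
    (h4 : t * m ^ 4 ≤ p * E) (h : t ^ (k + 4) ≤ m ^ k * (p * E)) :
    t ^ (5 * k + 12) ≤ (K * p) ^ (2 * k + 8) := by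
  have h1 : t ^ (5 * k + 16) ≤ (p * E) ^ (k + 4) := by
    calc t ^ (5 * k + 16) = t ^ k * (t ^ (k + 4)) ^ 4 := by ring
      _ ≤ t ^ k * (m ^ k * (p * E)) ^ 4 := by gcongr
      _ = (t * m ^ 4) ^ k * (p * E) ^ 4 := by
        rw [mul_pow (m ^ k), mul_pow t, ← pow_mul, ← pow_mul, mul_comm k 4]; ring
      _ ≤ (p * E) ^ k * (p * E) ^ 4 := by gcongr
      _ = _ := by ring
  have h2 : t ^ (10 * k + 32) ≤ (K * p) ^ (2 * k + 8) * t ^ (5 * k + 20) := by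
    calc t ^ (10 * k + 32) = (t ^ (5 * k + 16)) ^ 2 := by ring
      _ ≤ ((p * E) ^ (k + 4)) ^ 2 := by gcongr
      _ ≤ ((p * (K * t ^ 2 * r)) ^ (k + 4)) ^ 2 := by gcongr
      _ = ((K * p) ^ 2 * t ^ 4 * r ^ 2) ^ (k + 4) := by
        rw [← pow_mul, mul_comm (k + 4) 2, pow_mul]; ring
      _ = ((K * p) ^ 2 * t ^ 5) ^ (k + 4) := by rw [hrr]; ring
      _ = _ := by rw [mul_pow, ← pow_mul, ← pow_mul]; ring
  have h3 : t ^ (5 * k + 12) * t ^ (5 * k + 20) ≤ (K * p) ^ (2 * k + 8) * t ^ (5 * k + 20) := by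
    calc _ = t ^ (10 * k + 32) := by ring
      _ ≤ _ := h2
  exact le_of_mul_le_mul_right h3 (by positivity)

lemma numeric_two (p t m E r K : ℝ) (k : ℕ) (hp : 1 ≤ p) (ht : 0 < t) (hm : 0 ≤ m)
    (hE0 : 0 ≤ E) (hrr : r ^ 2 = t) (hE : E ≤ K * t ^ 2 * r)
    (h8 : m ^ 8 ≤ p * E ^ 2) (h : t ^ (k + 4) ≤ m ^ k * (p * E)) :
    t ^ (3 * k + 12) ≤ K ^ (2 * k + 8) * p ^ (k + 8) := by
  have hE2 : E ^ 2 ≤ K ^ 2 * t ^ 5 := by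
    calc E ^ 2 ≤ (K * t ^ 2 * r) ^ 2 := by gcongr
      _ = K ^ 2 * t ^ 4 * r ^ 2 := by ring
      _ = _ := by rw [hrr]; ring
  have h2 : t ^ (8 * k + 32) ≤ (K ^ (2 * k + 8) * p ^ (k + 8)) * t ^ (5 * k + 20) := by
    calc t ^ (8 * k + 32) = (t ^ (k + 4)) ^ 8 := by ring
      _ ≤ (m ^ k * (p * E)) ^ 8 := by gcongr
      _ = (m ^ 8) ^ k * (p * E) ^ 8 := by
        rw [mul_pow, ← pow_mul, ← pow_mul, mul_comm k 8]
      _ ≤ (p * E ^ 2) ^ k * (p * E) ^ 8 := by gcongr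
      _ = p ^ (k + 8) * (E ^ 2) ^ (k + 4) := by rw [mul_pow, mul_pow]; ring
      _ ≤ p ^ (k + 8) * (K ^ 2 * t ^ 5) ^ (k + 4) := by gcongr
      _ = _ := by rw [mul_pow, ← pow_mul, ← pow_mul]; ring
  have h3 : t ^ (3 * k + 12) * t ^ (5 * k + 20) ≤
      (K ^ (2 * k + 8) * p ^ (k + 8)) * t ^ (5 * k + 20) := by
    calc _ = t ^ (8 * k + 32) := by ring
      _ ≤ _ := h2
  exact le_of_mul_le_mul_right h3 (by positivity)

lemma numeric_contra (p t α : ℝ) (n a b : ℕ) (hp : 1 ≤ p) (hα : α * n = b) (han : a ≤ n)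
    (hn : n ≠ 0) (h : t ^ n ≤ 601 ^ a * p ^ b) (hC : 602 * p ^ α ≤ t) : False := by
  have hp0 : 0 < p := by linarith
  have h1 : (602 * p ^ α) ^ n ≤ t ^ n := by
    have : 0 < p ^ α := Real.rpow_pos_of_pos hp0 _
    gcongr
  rw [mul_pow, ← Real.rpow_mul_natCast hp0.le, hα, Real.rpow_natCast] at h1
  have h2 : (601 : ℝ) ^ a < 602 ^ n := by
    calc (601 : ℝ) ^ a ≤ 601 ^ n := pow_le_pow_right₀ (by norm_num) han
      _ < 602 ^ n := pow_lt_pow_left₀ (by norm_num) (by norm_num) hn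
  have h3 : (601 : ℝ) ^ a * p ^ b < 602 ^ n * p ^ b := by gcongr
  linarith

lemma subgroup_roots {p : ℕ} [Fact p.Prime] {R : Finset (ZMod p)} (h : IsMulSubgroup p R) :
    #R ≠ 0 ∧ ∀ x, x ∈ R ↔ x ^ #R = 1 := by
  obtain ⟨H, hH⟩ := h
  have hcard : #R = Nat.card H := by
    have h1 : (R : Set (ZMod p)).ncard = (Units.val '' (H : Set (ZMod p)ˣ)).ncard := by rw [hH]
    rw [Set.ncard_coe_finset, Set.ncard_image_of_injective _ Units.val_injective] at h1
    rw [h1]; rfl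
  have h0 : #R ≠ 0 := by rw [hcard]; exact Nat.card_pos.ne'
  refine ⟨h0, ?_⟩
  have hsub : R ⊆ (Finset.univ : Finset (ZMod p)).filter (fun y => y ^ #R = 1) := by
    intro x hx
    have : x ∈ (R : Set (ZMod p)) := hx
    rw [hH] at this
    obtain ⟨u, hu, rfl⟩ := this
    simp only [Finset.mem_filter, Finset.mem_univ, true_and]
    have h1 : (⟨u, hu⟩ : H) ^ Nat.card H = 1 := pow_card_eq_one'
    have h2 : u ^ Nat.card H = 1 := congrArg Subtype.val h1
    rw [hcard, ← Units.val_pow_eq_pow_val, h2, Units.val_one]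
  have heq := Finset.eq_of_subset_of_card_le hsub (card_roots_le' _ h0 1)
  intro x
  constructor
  · intro hx
    simpa using hsub hx
  · intro hx
    rw [heq]
    simpa using hx

theorem subgroup_basis_property :
    ∃ C : ℝ, 0 < C ∧
      ∀ p : ℕ, p.Prime →
        ∀ l : ℕ, 4 ≤ l →
          ∀ R : Finset (ZMod p), IsMulSubgroup p R →
            C * min ((p : ℝ) ^ ((2 * (l : ℝ) + 2) / (5 * (l : ℝ) - 3)))
                    ((p : ℝ) ^ (((l : ℝ) + 5) / (3 * (l : ℝ) + 3))) ≤ (R.card : ℝ) →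
            ∀ x : ZMod p, x ≠ 0 →
              ∃ r : Fin l → ZMod p, (∀ i, r i ∈ R) ∧ ∑ i, r i = x := by
  refine ⟨602, by norm_num, ?_⟩
  intro p hp l hl R hRsub hbound x hx
  have : Fact p.Prime := ⟨hp⟩
  by_contra hno
  obtain ⟨k, rfl⟩ : ∃ k, l = k + 3 := ⟨l - 3, by omega⟩
  obtain ⟨ht, hR⟩ := subgroup_roots hRsub
  obtain ⟨m, hm, h4, h8, h2, hA, hB⟩ := analytic_package ht hR rfl x hx k _ rfl hno
  set t := #R with hRt
  have hp1 : (1 : ℝ) ≤ p := by exact_mod_cast hp.one_lt.le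
  have htpos : (0 : ℝ) < t := by exact_mod_cast Nat.pos_of_ne_zero ht
  have htp : t ^ 3 ≤ p ^ 2 := by
    have := numeric_large p t m k hp1 htpos hm h2 hB
    exact_mod_cast this
  have hE := energy_bound ht hR rfl htp
  have hE0 : 0 ≤ ∑ v, (dcnt R v : ℝ) ^ 2 := by positivity
  have hrr : √(t : ℝ) ^ 2 = t := Real.sq_sqrt htpos.le
  have hk : (0 : ℝ) ≤ k := by positivity
  rcases min_choice ((p : ℝ) ^ ((2 * ((k + 3 : ℕ) : ℝ) + 2) / (5 * ((k + 3 : ℕ) : ℝ) - 3)))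
    ((p : ℝ) ^ ((((k + 3 : ℕ) : ℝ) + 5) / (3 * ((k + 3 : ℕ) : ℝ) + 3))) with hc | hc
  · rw [hc] at hbound
    have h := numeric_one p t m _ _ 601 k hp1 htpos hm hE0 hrr hE h4 hA
    rw [mul_pow] at h
    refine numeric_contra p t _ (5 * k + 12) (2 * k + 8) (2 * k + 8) hp1 ?_ (by omega)
      (by omega) h hbound
    push_cast
    have : 5 * ((k : ℝ) + 3) - 3 ≠ 0 := by nlinarith
    rw [div_mul_eq_mul_div, div_eq_iff this]
    ring
  · rw [hc] at hbound
    have h := numeric_two p t m _ _ 601 k hp1 htpos hm hE0 hrr hE h8 hA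
    refine numeric_contra p t _ (3 * k + 12) (2 * k + 8) (k + 8) hp1 ?_ (by omega)
      (by omega) h hbound
    push_cast
    have : 3 * ((k : ℝ) + 3) + 3 ≠ 0 := by positivity
    field_simp
    ring
end

section
/- Let G be a finite abelian group and A ⊆ G a finite set. Then Σ_{s ∈ G} Σ_{t ∈ G} E(A_s, A_t) = E₄(A). -/
open Finset Pointwise

/-- The additive energy `E(A,B)`: the number of quadruples `(a₁, a₂, b₁, b₂)`
with `a₁ + b₁ = a₂ + b₂`. -/
def addE {G : Type*} [AddCommGroup G] [DecidableEq G] (A B : Finset G) : ℕ :=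
  (((A ×ˢ A) ×ˢ B ×ˢ B).filter fun q => q.1.1 + q.2.1 = q.1.2 + q.2.2).card

theorem energy_E4_identity {G : Type*} [AddCommGroup G] [Fintype G] [DecidableEq G]
    (A : Finset G) :
    ∑ s : G, ∑ t : G,
        addE (A ∩ A.image (fun a => a - s)) (A ∩ A.image (fun a => a - t)) =
      ∑ s : G, (A ∩ A.image (fun a => a - s)).card ^ 4 := by
  have key : ∀ s x : G, x ∈ A ∩ A.image (fun a => a - s) ↔ x ∈ A ∧ x + s ∈ A := by
    intro s x
    simp only [mem_inter, mem_image]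
    constructor
    · rintro ⟨h, a, ha, rfl⟩
      exact ⟨h, by simpa using ha⟩
    · rintro ⟨h, h'⟩
      exact ⟨h, _, h', by simp⟩
  have hR : ∀ s : G, (A ∩ A.image (fun a => a - s)).card ^ 4 =
      (((A ∩ A.image (fun a => a - s)) ×ˢ (A ∩ A.image (fun a => a - s))) ×ˢ
        (A ∩ A.image (fun a => a - s)) ×ˢ (A ∩ A.image (fun a => a - s))).card := by
    intro s
    simp only [card_product]
    ring
  simp only [hR]
  rw [← Fintype.sum_prod_type']
  unfold addE
  rw [← card_sigma, ← card_sigma]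
  refine card_bij'
    (fun q _ => ⟨q.2.1.1 - q.2.1.2,
      ((q.2.1.2, q.2.1.2 + q.1.1), (q.2.2.1, q.2.2.1 + q.1.2))⟩)
    (fun r _ => ⟨(r.2.1.2 - r.2.1.1, r.2.2.2 - r.2.2.1),
      ((r.2.1.1 + r.1, r.2.1.1), (r.2.2.1, r.2.2.1 + r.1))⟩) ?_ ?_ ?_ ?_
  · rintro ⟨⟨s, t⟩, ⟨a₁, a₂⟩, b₁, b₂⟩ h
    simp only [mem_sigma, mem_univ, true_and, mem_filter, mem_product, key] at h ⊢
    obtain ⟨⟨⟨⟨h1, h2⟩, h3, h4⟩, ⟨h5, h6⟩, h7, h8⟩, e⟩ := h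
    have e' : b₂ = b₁ + (a₁ - a₂) := by
      rw [← sub_eq_of_eq_add' e]; abel
    subst e'
    refine ⟨⟨⟨h3, ?_⟩, h4, ?_⟩, ⟨h5, h7⟩, h6, ?_⟩
    · convert h1 using 1; abel
    · convert h2 using 1; abel
    · convert h8 using 1; abel
  · rintro ⟨u, ⟨x, y⟩, z, w⟩ h
    simp only [mem_sigma, mem_univ, true_and, mem_filter, mem_product, key] at h ⊢
    obtain ⟨⟨⟨h1, h2⟩, h3, h4⟩, ⟨h5, h6⟩, h7, h8⟩ := h
    refine ⟨⟨⟨⟨h2, ?_⟩, h1, ?_⟩, ⟨h5, ?_⟩, h6, ?_⟩, ?_⟩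
    · convert h4 using 1; abel
    · convert h3 using 1; abel
    · convert h7 using 1; abel
    · convert h8 using 1; abel
    · abel
  · rintro ⟨⟨s, t⟩, ⟨a₁, a₂⟩, b₁, b₂⟩ h
    simp only [mem_sigma, mem_univ, true_and, mem_filter, mem_product, key] at h
    have e' : b₂ = b₁ + (a₁ - a₂) := by
      rw [← sub_eq_of_eq_add' h.2]; abel
    subst e'
    simp
  · rintro ⟨u, ⟨x, y⟩, z, w⟩ h
    simp
end

section
/- Let G be a finite abelian group and A ⊆ G a finite set with at least 2 elements. Then Σ_{s ≠ 0} |A − A_s| ≥ |A|⁶ / (2·E₃(A)) and Σ_{s ≠ 0} |A + A_s| ≥ |A|⁶ / (2·E₃(A)), where the sums range over nonzero s ∈ G. -/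
open Finset Pointwise

/-- The set of `x ∈ A` with `x + s ∈ A`. -/
def shInt {G : Type*} [AddCommGroup G] [DecidableEq G] (A : Finset G) (s : G) : Finset G :=
  A.filter (fun x => x + s ∈ A)

theorem shInt_eq {G : Type*} [AddCommGroup G] [DecidableEq G] (A : Finset G) (s : G) :
    A ∩ A.image (fun a => a - s) = shInt A s := by
  ext x
  simp only [shInt, mem_inter, mem_image, mem_filter, and_congr_right_iff]
  intro _
  constructor
  · rintro ⟨a, ha, rfl⟩
    simpa using ha
  · intro h
    exact ⟨x + s, h, by simp⟩

theorem shInt_zero {G : Type*} [AddCommGroup G] [DecidableEq G] (A : Finset G) :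
    shInt A 0 = A := by
  simp [shInt]

theorem shInt_comm {G : Type*} [AddCommGroup G] [DecidableEq G] (A : Finset G) (s t : G) :
    shInt (shInt A s) t = shInt (shInt A t) s := by
  ext x
  simp only [shInt, mem_filter, add_right_comm x t s]
  tauto

theorem card_shInt_neg {G : Type*} [AddCommGroup G] [DecidableEq G] (A : Finset G) (t : G) :
    (shInt (-A) t).card = (shInt A t).card := by
  refine card_nbij' (fun x => -x - t) (fun x => -x - t) ?_ ?_ ?_ ?_
  · intro x hx
    simp only [shInt, coe_filter, mem_neg', Set.mem_ofPred_eq] at hx ⊢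
    refine ⟨?_, by simpa using hx.1⟩
    have := hx.2
    rwa [neg_add, ← sub_eq_add_neg] at this
  · intro x hx
    simp only [shInt, coe_filter, mem_neg', Set.mem_ofPred_eq] at hx ⊢
    refine ⟨?_, by simpa using hx.1⟩
    have e : -(-x - t) = x + t := by abel
    rw [e]; exact hx.2
  · intro x _; simp
  · intro x _; simp

theorem sum_card_shInt {G : Type*} [AddCommGroup G] [Fintype G] [DecidableEq G]
    (A : Finset G) : ∑ s : G, (shInt A s).card = A.card ^ 2 := by
  have h := card_eq_sum_card_fiberwise (f := fun p : G × G => p.2 - p.1) (s := A ×ˢ A)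
    (t := univ) (fun _ _ => by simp)
  rw [sq, ← card_product, h]
  refine sum_congr rfl fun s _ => ?_
  refine card_nbij' (fun x => (x, x + s)) (fun p => p.1) ?_ ?_ ?_ ?_
  · intro x hx
    simpa [shInt] using hx
  · rintro ⟨x, y⟩ hx
    simp only [shInt, coe_filter, mem_product, Set.mem_ofPred_eq] at hx ⊢
    obtain ⟨⟨h1, h2⟩, rfl⟩ := hx
    exact ⟨h1, by simpa using h2⟩
  · intro x _; simp
  · rintro ⟨x, y⟩ hx
    simp only [coe_filter, mem_product, Set.mem_ofPred_eq] at hx ⊢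
    obtain ⟨⟨h1, h2⟩, rfl⟩ := hx
    simp

theorem addEnergy_eq_sum_shInt {G : Type*} [AddCommGroup G] [Fintype G] [DecidableEq G]
    (A B : Finset G) :
    Finset.addEnergy A B = ∑ t : G, (shInt A t).card * (shInt B t).card := by
  have h := card_eq_sum_card_fiberwise (f := fun p : (G × G) × G × G => p.1.1 - p.1.2)
    (s := {x ∈ ((A ×ˢ A) ×ˢ B ×ˢ B) | x.1.1 + x.2.1 = x.1.2 + x.2.2})
    (t := univ) (fun _ _ => by simp)
  rw [Finset.addEnergy, h]
  refine sum_congr rfl fun t _ => ?_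
  rw [← card_product]
  refine card_nbij' (fun p => (p.1.2, p.2.1)) (fun p => ((p.1 + t, p.1), p.2, p.2 + t))
    ?_ ?_ ?_ ?_
  · rintro ⟨⟨a, b⟩, c, d⟩ hx
    simp only [shInt, coe_filter, mem_filter, mem_product, Set.mem_ofPred_eq, coe_product,
      Set.mem_prod] at hx ⊢
    obtain ⟨⟨⟨⟨h1, h2⟩, h3, h4⟩, h5⟩, rfl⟩ := hx
    have e : c + (a - b) = d := by
      have : d = a + c - b := by rw [h5]; abel
      rw [this]; abel
    exact ⟨⟨h2, by simpa using h1⟩, h3, by rw [e]; exact h4⟩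
  · rintro ⟨x, y⟩ hx
    simp only [shInt, coe_filter, mem_filter, mem_product, Set.mem_ofPred_eq, coe_product,
      Set.mem_prod] at hx ⊢
    obtain ⟨⟨h1, h2⟩, h3, h4⟩ := hx
    exact ⟨⟨⟨⟨h2, h1⟩, h3, h4⟩, by abel⟩, by abel⟩
  · rintro ⟨⟨a, b⟩, c, d⟩ hx
    simp only [coe_filter, mem_filter, mem_product, Set.mem_ofPred_eq] at hx ⊢
    obtain ⟨⟨⟨⟨h1, h2⟩, h3, h4⟩, h5⟩, rfl⟩ := hx
    have e : c + (a - b) = d := by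
      have : d = a + c - b := by rw [h5]; abel
      rw [this]; abel
    simp [e]
  · rintro ⟨x, y⟩ _; simp

theorem final_arith {n S T E : ℝ} (hn2 : 2 ≤ n) (hS0 : 0 ≤ S) (hT : 0 < T)
    (hCS : (n * (n ^ 2 - n)) ^ 2 ≤ S * E) (h2 : n * E ≤ (n - 1) * T) :
    n ^ 6 / (2 * T) ≤ S := by
  rw [div_le_iff₀ (by positivity)]
  have h3 := mul_le_mul_of_nonneg_left h2 hS0
  have h4 := mul_le_mul_of_nonneg_left hCS (by linarith : 0 ≤ n)
  have h5 : (n - 1) * (n ^ 5 * (n - 1)) ≤ (n - 1) * (S * T) := by linarith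
  have h6 := le_of_mul_le_mul_left h5 (by linarith)
  have h7 : 0 ≤ n ^ 5 * (n - 2) := mul_nonneg (by positivity) (by linarith)
  linarith

set_option maxHeartbeats 1000000 in
theorem shInt_bound {G : Type*} [AddCommGroup G] [Fintype G] [DecidableEq G]
    (A : Finset G) (hA : 2 ≤ A.card) (N : G → ℕ)
    (hN : ∀ s, A.card ^ 2 * (shInt A s).card ^ 2 ≤
      N s * ∑ t : G, (shInt A t).card * (shInt (shInt A s) t).card) :
    (A.card : ℝ) ^ 6 / (2 * ∑ s : G, ((shInt A s).card : ℝ) ^ 3) ≤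
        ∑ s ∈ Finset.univ.filter (fun s : G => s ≠ 0), (N s : ℝ) := by
  set n : ℝ := (A.card : ℝ) with hn
  have hn2 : (2 : ℝ) ≤ n := by rw [hn]; exact_mod_cast hA
  have hsplit : ∀ f : G → ℝ, ∑ s ∈ univ.filter (fun s : G => s ≠ 0), f s = ∑ s, f s - f 0 := by
    intro f
    rw [filter_ne', eq_sub_iff_add_eq, sum_erase_add _ _ (mem_univ _)]
  have hle : ∀ t, ((shInt A t).card : ℝ) ≤ n := fun t => by
    have h : (shInt A t).card ≤ A.card := card_le_card (filter_subset _ _)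
    exact Nat.cast_le.2 h
  have hCS := sum_sq_le_sum_mul_sum_of_sq_le_mul (univ.filter (fun s : G => s ≠ 0))
    (r := fun s => n * ((shInt A s).card : ℝ)) (f := fun s => (N s : ℝ))
    (g := fun s => ∑ t : G, ((shInt A t).card : ℝ) * ((shInt (shInt A s) t).card : ℝ))
    (fun _ _ => Nat.cast_nonneg _)
    (fun _ _ => sum_nonneg fun _ _ => mul_nonneg (Nat.cast_nonneg _) (Nat.cast_nonneg _))
    (fun s _ => by
      have := hN s
      rw [mul_pow, hn]
      exact_mod_cast this)
  have h1 : ∑ s ∈ univ.filter (fun s : G => s ≠ 0), n * ((shInt A s).card : ℝ)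
      = n * (n ^ 2 - n) := by
    rw [← mul_sum, hsplit, shInt_zero]
    congr 2
    rw [hn]
    exact_mod_cast sum_card_shInt A
  have h2 : n * ∑ s ∈ univ.filter (fun s : G => s ≠ 0),
      ∑ t : G, ((shInt A t).card : ℝ) * ((shInt (shInt A s) t).card : ℝ)
      ≤ (n - 1) * ∑ s : G, ((shInt A s).card : ℝ) ^ 3 := by
    rw [sum_comm, mul_sum, mul_sum]
    refine sum_le_sum fun t _ => ?_
    rw [← mul_sum, hsplit, shInt_zero]
    have : ∑ s, ((shInt (shInt A s) t).card : ℝ) = ((shInt A t).card : ℝ) ^ 2 := by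
      simp_rw [fun s => shInt_comm A s t]
      exact_mod_cast sum_card_shInt (shInt A t)
    rw [this]
    have h0 : (0 : ℝ) ≤ ((shInt A t).card : ℝ) := Nat.cast_nonneg _
    have := mul_nonneg (mul_nonneg h0 h0) (sub_nonneg.2 (hle t))
    nlinarith
  have hpos : 0 < ∑ s : G, ((shInt A s).card : ℝ) ^ 3 := by
    have := single_le_sum (f := fun s : G => ((shInt A s).card : ℝ) ^ 3)
      (fun _ _ => pow_nonneg (Nat.cast_nonneg _) 3) (mem_univ 0)
    simp only [shInt_zero] at this
    have : 0 < n ^ 3 := pow_pos (by linarith) 3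
    linarith
  rw [h1] at hCS
  exact final_arith hn2 (sum_nonneg fun _ _ => Nat.cast_nonneg _) hpos hCS h2

theorem sumsets_with_A_s_lower_bound {G : Type*} [AddCommGroup G] [Fintype G] [DecidableEq G]
    (A : Finset G) (hA : 2 ≤ A.card) :
    (A.card : ℝ) ^ 6 / (2 * ∑ s : G, ((A ∩ A.image (fun a => a - s)).card : ℝ) ^ 3) ≤
        ∑ s ∈ Finset.univ.filter (fun s : G => s ≠ 0),
          ((A - (A ∩ A.image (fun a => a - s))).card : ℝ) ∧
    (A.card : ℝ) ^ 6 / (2 * ∑ s : G, ((A ∩ A.image (fun a => a - s)).card : ℝ) ^ 3) ≤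
        ∑ s ∈ Finset.univ.filter (fun s : G => s ≠ 0),
          ((A + (A ∩ A.image (fun a => a - s))).card : ℝ) := by
  simp only [shInt_eq]
  constructor
  · refine shInt_bound A hA (fun s => (A - shInt A s).card) fun s => ?_
    have h := Finset.le_card_add_mul_addEnergy A (-(shInt A s))
    rw [addEnergy_eq_sum_shInt, ← sub_eq_add_neg, card_neg] at h
    simpa only [card_shInt_neg] using h
  · refine shInt_bound A hA (fun s => (A + shInt A s).card) fun s => ?_
    have h := Finset.le_card_add_mul_addEnergy A (shInt A s)
    rwa [addEnergy_eq_sum_shInt] at h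
end

section
/- There exist constants c > 0 and C > 0 such that for every prime p and every multiplicative subgroup R ⊆ F_p* with 2 ≤ |R| ≤ c·p^{2/3}, one has E₃(R) ≤ C·|R|³·log |R|. -/
open Finset Pointwise

open Polynomial in
theorem sparse_lemma {p : ℕ} [Fact p.Prime] (r : ZMod p) (hr : r ≠ 0) (m : ℕ) :
    ∀ f : (ZMod p)[X], f.support.card ≤ m → (∀ n ∈ f.support, n < p) →
      (X - C r) ^ m ∣ f → f = 0 := by
  induction m with
  | zero =>
    intro f hc _ _
    simpa using hc
  | succ m ih =>
    intro f hc hd hdvd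
    by_contra hf
    obtain ⟨e, he⟩ := Polynomial.nonempty_support_iff.mpr hf
    set g : (ZMod p)[X] := X * derivative f - C (e : ZMod p) * f with hg
    have hco : ∀ n, g.coeff n = ((n : ZMod p) - e) * f.coeff n := by
      intro n
      rw [hg, coeff_sub, coeff_C_mul]
      cases n with
      | zero => simp
      | succ n => rw [coeff_X_mul, coeff_derivative]; push_cast; ring
    have hsub : g.support ⊆ f.support.erase e := by
      intro n hn
      rw [mem_support_iff, hco] at hn
      rw [Finset.mem_erase, mem_support_iff]
      refine ⟨?_, right_ne_zero_of_mul hn⟩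
      rintro rfl
      simp at hn
    have hg0 : g = 0 := by
      apply ih
      · have := Finset.card_le_card hsub
        rw [Finset.card_erase_of_mem he] at this
        omega
      · intro n hn
        exact hd n (Finset.mem_of_mem_erase (hsub hn))
      · obtain ⟨h, rfl⟩ := hdvd
        rw [hg]
        refine ⟨X * (C ((m : ZMod p) + 1) * h + (X - C r) * derivative h) - C (e : ZMod p) * ((X - C r) * h), ?_⟩
        simp only [derivative_mul, derivative_pow, derivative_sub, derivative_X, derivative_C]
        simp
        ring
    have hfe : f = C (f.coeff e) * X ^ e := by
      ext n
      rw [coeff_C_mul, coeff_X_pow]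
      by_cases hne : n = e
      · simp [hne]
      · simp only [hne, if_false, mul_zero]
        by_contra hn
        have h1 := hco n
        rw [hg0, coeff_zero] at h1
        rcases mul_eq_zero.mp h1.symm with h2 | h2
        · rw [sub_eq_zero] at h2
          have := (ZMod.natCast_eq_natCast_iff' _ _ _).mp h2
          rw [Nat.mod_eq_of_lt (hd n (mem_support_iff.mpr hn)), Nat.mod_eq_of_lt (hd e he)] at this
          exact hne this
        · exact hn h2
    have hroot : f.eval r = 0 := by
      have : (X - C r) ∣ f := dvd_trans (dvd_pow_self _ (by omega)) hdvd
      exact dvd_iff_isRoot.mp this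
    rw [hfe] at hroot
    simp [hr] at hroot
    exact (mem_support_iff.mp he) hroot

open Polynomial in
theorem eval_iter_aux {K : Type*} [Field K] (w : K[X]) (y : K) (j : ℕ) :
    ∀ h : K[X], ((fun f => w * derivative f)^[j] ((X - C y) ^ j * h)).eval y
      = (j.factorial : K) * (w.eval y) ^ j * h.eval y := by
  induction j with
  | zero => intro h; simp
  | succ j ih =>
    intro h
    rw [Function.iterate_succ_apply]
    have : w * derivative ((X - C y) ^ (j + 1) * h)
        = (X - C y) ^ j * (w * (C ((j : K) + 1) * h + (X - C y) * derivative h)) := by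
      simp only [derivative_mul, derivative_pow, derivative_sub, derivative_X, derivative_C]
      simp
      ring
    rw [this, ih, Nat.factorial_succ]
    simp
    ring

open Polynomial in
theorem dvd_of_iter {p : ℕ} [Fact p.Prime] (w f : (ZMod p)[X]) (y : ZMod p) (hw : w.eval y ≠ 0)
    (D : ℕ) (hD : D ≤ p) (h : ∀ m < D, ((fun f => w * derivative f)^[m] f).eval y = 0) :
    (X - C y) ^ D ∣ f := by
  induction D with
  | zero => simp
  | succ D ih =>
    obtain ⟨q, hq⟩ := ih (by omega) (fun m hm => h m (by omega))
    have h1 := h D (by omega)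
    rw [hq, eval_iter_aux] at h1
    have hfac : (D.factorial : ZMod p) ≠ 0 := by
      rw [Ne, ZMod.natCast_eq_zero_iff, (Fact.out : p.Prime).dvd_factorial]
      omega
    have h2 : q.eval y = 0 := by
      rcases mul_eq_zero.mp h1 with h2 | h2
      · exact absurd h2 (mul_ne_zero hfac (pow_ne_zero _ hw))
      · exact h2
    rw [hq, pow_succ]
    exact mul_dvd_mul_left _ (dvd_iff_isRoot.mpr h2)

open Polynomial in
/-- The operator on coefficients induced by `X (X + 1) d/dX`. -/
noncomputable def stT (K : Type*) [Field K] (t b c : ℕ) : K[X] →ₗ[K] K[X] :=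
  LinearMap.mulLeft K (X * (X + 1)) ∘ₗ derivative +
    LinearMap.mulLeft K (C ((b * t : ℕ) : K) * (X + 1) + C ((c * t : ℕ) : K) * X)

open Polynomial in
theorem stT_apply {K : Type*} [Field K] (t b c : ℕ) (g : K[X]) :
    stT K t b c g = X * (X + 1) * derivative g +
      (C ((b * t : ℕ) : K) * (X + 1) + C ((c * t : ℕ) : K) * X) * g := by
  simp [stT, mul_assoc]

open Polynomial in
theorem mul_deriv_pow {K : Type*} [Field K] (f : K[X]) (n : ℕ) :
    f * derivative (f ^ n) = C (n : K) * derivative f * f ^ n := by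
  cases n with
  | zero => simp
  | succ n => rw [derivative_pow_succ]; push_cast; simp; ring

open Polynomial in
theorem stT_spec {K : Type*} [Field K] (t b c : ℕ) (g : K[X]) :
    X * (X + 1) * derivative (g * X ^ (b * t) * (X + 1) ^ (c * t))
      = stT K t b c g * X ^ (b * t) * (X + 1) ^ (c * t) := by
  have h1 := mul_deriv_pow (X : K[X]) (b * t)
  have h2 := mul_deriv_pow (X + 1 : K[X]) (c * t)
  have e : derivative (X + 1 : K[X]) = 1 := by simp
  rw [derivative_X] at h1
  rw [e] at h2
  rw [stT_apply, derivative_mul, derivative_mul]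
  linear_combination (g * (X + 1) * (X + 1) ^ (c * t)) * h1 + (g * X ^ (b * t) * X) * h2

open Polynomial in
theorem stT_deg {K : Type*} [Field K] (t b c n : ℕ) (g : K[X]) (hg : g.natDegree ≤ n) :
    (stT K t b c g).natDegree ≤ n + 1 := by
  rw [stT_apply]
  apply natDegree_add_le_of_degree_le
  · rcases Nat.eq_zero_or_pos n with rfl | hn
    · rw [natDegree_eq_zero.mp (Nat.le_zero.mp hg) |>.choose_spec.symm]
      simp
    · have h1 : (X * (X + 1) : K[X]).natDegree ≤ 2 := by compute_degree
      have h2 := natDegree_derivative_le g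
      refine (natDegree_mul_le).trans ?_
      omega
  · have h1 : (C ((b * t : ℕ) : K) * (X + 1) + C ((c * t : ℕ) : K) * X).natDegree ≤ 1 := by
      compute_degree
    refine (natDegree_mul_le).trans ?_
    omega

open Polynomial in
theorem stT_pow_deg {K : Type*} [Field K] (t b c n m : ℕ) (g : K[X]) (hg : g.natDegree ≤ n) :
    ((stT K t b c ^ m) g).natDegree ≤ n + m := by
  induction m with
  | zero => simpa using hg
  | succ m ih =>
    rw [pow_succ', Module.End.mul_apply]
    exact stT_deg _ _ _ _ _ ih

open Polynomial in
/-- Polynomial with given coefficients. -/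
noncomputable def stG (K : Type*) [Field K] (A B : ℕ) (bc : Fin B × Fin B) :
    ((Fin B × Fin B) × Fin A → K) →ₗ[K] K[X] :=
  ∑ a : Fin A, (monomial (a : ℕ)) ∘ₗ LinearMap.proj (bc, a)

open Polynomial in
theorem stG_coeff {K : Type*} [Field K] (A B : ℕ) (bc : Fin B × Fin B)
    (u : (Fin B × Fin B) × Fin A → K) (n : ℕ) :
    (stG K A B bc u).coeff n = if h : n < A then u (bc, ⟨n, h⟩) else 0 := by
  simp only [stG, LinearMap.sum_apply, LinearMap.comp_apply, LinearMap.proj_apply, finsetSum_coeff,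
    coeff_monomial]
  split_ifs with h
  · rw [Finset.sum_eq_single ⟨n, h⟩]
    · simp
    · intro b _ hb
      rw [if_neg]
      intro h'
      exact hb (Fin.ext h')
    · simp
  · apply Finset.sum_eq_zero
    intro a _
    rw [if_neg]
    have := a.2
    omega

open Polynomial in
theorem stG_deg {K : Type*} [Field K] (A B : ℕ) (bc : Fin B × Fin B)
    (u : (Fin B × Fin B) × Fin A → K) : (stG K A B bc u).natDegree ≤ A - 1 := by
  rw [natDegree_le_iff_coeff_eq_zero]
  intro n hn
  rw [stG_coeff, dif_neg (by omega)]

open Polynomial in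
theorem st_exists {K : Type*} [Field K] (t A B : ℕ) (Λ : Finset K)
    (hk : 2 * Λ.card * A < B ^ 2) (hA : 0 < A) :
    ∃ u : (Fin B × Fin B) × Fin A → K, u ≠ 0 ∧ ∀ l ∈ Λ, ∀ m < A,
      ∑ bc : Fin B × Fin B, (l ^ ((bc.1 : ℕ) + bc.2)) • (stT K t bc.1 bc.2 ^ m) (stG K A B bc u) = 0 := by
  let P : K → ℕ → ((Fin B × Fin B) × Fin A → K) →ₗ[K] K[X] := fun l m =>
    ∑ bc : Fin B × Fin B, (l ^ ((bc.1 : ℕ) + bc.2)) • ((stT K t bc.1 bc.2 ^ m) ∘ₗ (stG K A B bc))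
  let L : ((Fin B × Fin B) × Fin A → K) →ₗ[K] (Λ × Fin A × Fin (2 * A) → K) :=
    LinearMap.pi fun x => lcoeff K (x.2.2 : ℕ) ∘ₗ P x.1 x.2.1
  have hker : LinearMap.ker L ≠ ⊥ := by
    apply LinearMap.ker_ne_bot_of_finrank_lt
    simp
    nlinarith
  obtain ⟨u, hu, hu0⟩ := (Submodule.ne_bot_iff _).mp hker
  refine ⟨u, hu0, ?_⟩
  intro l hl m hm
  have hP : P l m u = ∑ bc : Fin B × Fin B,
      (l ^ ((bc.1 : ℕ) + bc.2)) • (stT K t bc.1 bc.2 ^ m) (stG K A B bc u) := by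
    simp [P]
  rw [← hP]
  ext n
  rw [coeff_zero]
  by_cases hn : n < 2 * A
  · have := congrFun (LinearMap.mem_ker.mp hu) (⟨l, hl⟩, ⟨m, hm⟩, ⟨n, hn⟩)
    simpa [L] using this
  · apply coeff_eq_zero_of_natDegree_lt
    refine lt_of_le_of_lt ?_ (Nat.lt_of_lt_of_le ?_ (not_lt.mp hn)) (b := 2 * A - 1)
    · rw [hP]
      apply natDegree_sum_le_of_forall_le
      intro bc _
      refine (natDegree_smul_le _ _).trans ?_
      refine (stT_pow_deg _ _ _ (A - 1) _ _ (stG_deg _ _ _ _)).trans ?_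
      omega
    · omega

open Polynomial in
theorem st_iter {K : Type*} [Field K] (t A B m : ℕ) (u : (Fin B × Fin B) × Fin A → K) :
    ((fun f : K[X] => X * (X + 1) * derivative f)^[m]
      (∑ bc : Fin B × Fin B, stG K A B bc u * X ^ ((bc.1 : ℕ) * t) * (X + 1) ^ ((bc.2 : ℕ) * t))) =
      ∑ bc : Fin B × Fin B, (stT K t bc.1 bc.2 ^ m) (stG K A B bc u)
        * X ^ ((bc.1 : ℕ) * t) * (X + 1) ^ ((bc.2 : ℕ) * t) := by
  induction m with
  | zero => simp
  | succ m ih =>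
    rw [Function.iterate_succ_apply', ih]
    simp only [derivative_sum, Finset.mul_sum, stT_spec]
    simp only [pow_succ', Module.End.mul_apply]

open Polynomial in
theorem st_nonzero {p : ℕ} [Fact p.Prime] (t A B : ℕ) (hA : 0 < A) (hAB : A * B ≤ t)
    (hBt : B * t ≤ p) (u : (Fin B × Fin B) × Fin A → ZMod p)
    (h : ∑ bc : Fin B × Fin B, stG (ZMod p) A B bc u * X ^ ((bc.1 : ℕ) * t)
      * (X + 1) ^ ((bc.2 : ℕ) * t) = 0) : u = 0 := by
  set Q : Fin B → (ZMod p)[X] := fun c => ∑ b : Fin B, stG (ZMod p) A B (b, c) u * X ^ ((b : ℕ) * t)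
    with hQ
  have hcQ : ∀ c (b : Fin B) (a : Fin A), (Q c).coeff (a + b * t) = u ((b, c), a) := by
    intro c b a
    have hAt : A ≤ t := le_trans (Nat.le_mul_of_pos_right _ b.pos) hAB
    simp only [hQ, finsetSum_coeff, coeff_mul_X_pow']
    rw [Finset.sum_eq_single b]
    · simp [stG_coeff]
    · intro b' _ hb'
      split_ifs with hle
      · rw [stG_coeff, dif_neg]
        have hlt : (b' : ℕ) < b := by
          by_contra hcon
          have h1 : (b : ℕ) < b' := lt_of_le_of_ne (not_lt.mp hcon) (fun h => hb' (Fin.ext h.symm))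
          have h2 : ((b : ℕ) + 1) * t ≤ b' * t := Nat.mul_le_mul_right _ h1
          have := a.2
          nlinarith
        have h2 : ((b' : ℕ) + 1) * t ≤ b * t := Nat.mul_le_mul_right _ hlt
        have : ((b' : ℕ) + 1) * t = b' * t + t := by ring
        omega
      · rfl
    · simp
  have hQsupp : ∀ c, (Q c).support ⊆ (Finset.univ : Finset (Fin B × Fin A)).image
      (fun x => (x.2 : ℕ) + x.1 * t) := by
    intro c n hn
    rw [mem_support_iff] at hn
    simp only [hQ, finsetSum_coeff, coeff_mul_X_pow'] at hn
    obtain ⟨b, _, hb⟩ := Finset.exists_ne_zero_of_sum_ne_zero hn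
    split_ifs at hb with hle
    · rw [stG_coeff] at hb
      split_ifs at hb with hlt
      · rw [Finset.mem_image]
        exact ⟨(b, ⟨_, hlt⟩), Finset.mem_univ _, by simp; omega⟩
      · exact absurd rfl hb
    · exact absurd rfl hb
  have hsum : ∑ c : Fin B, Q c * (X + 1) ^ ((c : ℕ) * t) = 0 := by
    rw [Fintype.sum_prod_type_right] at h
    rw [← h]
    apply Finset.sum_congr rfl
    intro c _
    rw [hQ, Finset.sum_mul]
  have hQ0 : ∀ n : ℕ, ∀ c : Fin B, (c : ℕ) = n → Q c = 0 := by
    intro n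
    induction n using Nat.strong_induction_on with
    | _ n ih =>
      rintro c rfl
      have hX : (X - C (-1) : (ZMod p)[X]) = X + 1 := by simp
      apply sparse_lemma (-1 : ZMod p) (by simp) t
      · refine (Finset.card_le_card (hQsupp c)).trans (Finset.card_image_le.trans ?_)
        simp
        linarith
      · intro n hn
        obtain ⟨x, _, hx⟩ := Finset.mem_image.mp (hQsupp c hn)
        have h1 := x.1.2
        have h2 := x.2.2
        have hAt : A ≤ t := le_trans (Nat.le_mul_of_pos_right _ x.1.pos) hAB
        have h3 : ((x.1 : ℕ) + 1) * t ≤ B * t := Nat.mul_le_mul_right _ h1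
        have h4 : ((x.1 : ℕ) + 1) * t = x.1 * t + t := by ring
        omega
      · rw [hX]
        have hne : (X + 1 : (ZMod p)[X]) ≠ 0 := by
          rw [← hX]; exact X_sub_C_ne_zero _
        have hdvd : (X + 1) ^ ((c : ℕ) * t) * (X + 1) ^ t ∣ (X + 1) ^ ((c : ℕ) * t) * Q c := by
          have e : (X + 1) ^ ((c : ℕ) * t) * Q c =
              - ∑ c' ∈ Finset.univ.erase c, Q c' * (X + 1) ^ ((c' : ℕ) * t) := by
            rw [← Finset.add_sum_erase _ _ (Finset.mem_univ c)] at hsum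
            linear_combination hsum
          rw [e, dvd_neg]
          apply Finset.dvd_sum
          intro c' hc'
          rcases lt_trichotomy (c' : ℕ) c with hlt | heq | hgt
          · rw [ih _ hlt c' rfl]; simp
          · exact absurd (Fin.ext heq) (Finset.ne_of_mem_erase hc')
          · rw [← pow_add]
            apply dvd_mul_of_dvd_right
            apply pow_dvd_pow
            have h3 : ((c : ℕ) + 1) * t ≤ c' * t := Nat.mul_le_mul_right _ hgt
            linarith
        exact (mul_dvd_mul_iff_left (pow_ne_zero _ hne)).mp hdvd
  ext ⟨⟨b, c⟩, a⟩
  rw [← hcQ, hQ0 _ c rfl]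
  simp

open Polynomial in
theorem stepanov {p : ℕ} [Fact p.Prime] (t A B : ℕ) (Λ S : Finset (ZMod p))
    (hS : ∀ y ∈ S, y ≠ 0 ∧ y + 1 ≠ 0 ∧ y ^ t ∈ Λ ∧ (y + 1) ^ t = y ^ t)
    (hk : 2 * Λ.card * A < B ^ 2) (hA : 0 < A) (hAB : A * B ≤ t) (hBt : B * t ≤ p) :
    A * S.card ≤ 2 * B * t := by
  obtain ⟨u, hu0, hu⟩ := st_exists t A B Λ hk hA
  have hB : 0 < B := by
    rcases Nat.eq_zero_or_pos B with rfl | h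
    · simp at hk
    · exact h
  have hAt : A ≤ t := le_trans (Nat.le_mul_of_pos_right _ hB) hAB
  have htp : t ≤ p := le_trans (Nat.le_mul_of_pos_left _ hB) hBt
  set Ψ : (ZMod p)[X] := ∑ bc : Fin B × Fin B, stG (ZMod p) A B bc u * X ^ ((bc.1 : ℕ) * t)
    * (X + 1) ^ ((bc.2 : ℕ) * t) with hΨ
  have hΨ0 : Ψ ≠ 0 := fun h => hu0 (st_nonzero t A B hA hAB hBt u h)
  have hdeg : Ψ.natDegree ≤ 2 * B * t := by
    apply natDegree_sum_le_of_forall_le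
    intro bc _
    have h1 := stG_deg A B bc u
    have h2 : (X ^ ((bc.1 : ℕ) * t) : (ZMod p)[X]).natDegree ≤ bc.1 * t := natDegree_X_pow_le _
    have h3 : ((X + 1) ^ ((bc.2 : ℕ) * t) : (ZMod p)[X]).natDegree ≤ bc.2 * t := by
      refine natDegree_pow_le.trans ?_
      have : (X + 1 : (ZMod p)[X]).natDegree ≤ 1 := by compute_degree
      exact (Nat.mul_le_mul_left _ this).trans (by simp)
    have h4 : ((bc.1 : ℕ) + 1) * t ≤ B * t := Nat.mul_le_mul_right _ bc.1.2
    have h5 : ((bc.2 : ℕ) + 1) * t ≤ B * t := Nat.mul_le_mul_right _ bc.2.2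
    refine natDegree_mul_le.trans ((Nat.add_le_add natDegree_mul_le le_rfl).trans ?_)
    have : A - 1 ≤ t := by omega
    nlinarith
  have hdvd : ∏ y ∈ S, (X - C y) ^ A ∣ Ψ := by
    apply Finset.prod_dvd_of_coprime
    · intro x _ y _ hxy
      exact (isCoprime_X_sub_C_of_isUnit_sub (sub_ne_zero.mpr hxy).isUnit).pow
    · intro y hy
      obtain ⟨h0, h1, hl, he⟩ := hS y hy
      apply dvd_of_iter (X * (X + 1)) Ψ y
      · simp [h0, h1]
      · omega
      · intro m hm
        rw [hΨ, st_iter]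
        have := congrArg (eval y) (hu _ hl m hm)
        rw [eval_zero] at this
        rw [← this, eval_finsetSum, eval_finsetSum]
        apply Finset.sum_congr rfl
        intro bc _
        simp only [eval_mul, eval_pow, eval_X, eval_add, eval_one, eval_smul, smul_eq_mul]
        rw [mul_comm (bc.1 : ℕ) t, mul_comm (bc.2 : ℕ) t, pow_mul, pow_mul, he, pow_add]
        ring
  have h1 := natDegree_le_of_dvd hdvd hΨ0
  rw [natDegree_prod _ _ (fun y _ => pow_ne_zero _ (X_sub_C_ne_zero y))] at h1
  simp at h1
  linarith

theorem st_param {p : ℕ} [Fact p.Prime] (t n : ℕ) (Λ S : Finset (ZMod p))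
    (hS : ∀ y ∈ S, y ≠ 0 ∧ y + 1 ≠ 0 ∧ y ^ t ∈ Λ ∧ (y + 1) ^ t = y ^ t)
    (ht : 4096 ≤ t) (hk1 : 1 ≤ Λ.card) (hkt : Λ.card ≤ t) (hkp : Λ.card * t ^ 4 ≤ p ^ 3)
    (hn : n * Λ.card ≤ S.card) : n ^ 3 * Λ.card ≤ 32768 * t ^ 2 := by
  set k := Λ.card with hk
  obtain ⟨B, hB1, hB2⟩ : ∃ B : ℕ, B ^ 3 ≤ k * t ∧ k * t < (B + 1) ^ 3 := by
    refine ⟨Nat.findGreatest (fun B => B ^ 3 ≤ k * t) (k * t), ?_, ?_⟩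
    · exact Nat.findGreatest_spec (P := fun B => B ^ 3 ≤ k * t) (Nat.zero_le _) (by simp)
    · by_contra hcon
      have hcon := not_lt.mp hcon
      have h1 : Nat.findGreatest (fun B => B ^ 3 ≤ k * t) (k * t) + 1 ≤ k * t :=
        le_trans (Nat.le_self_pow (by norm_num) _) hcon
      exact Nat.findGreatest_is_greatest (Nat.lt_succ_self _) h1 hcon
  have hBpos : 1 ≤ B := by
    rcases Nat.eq_zero_or_pos B with rfl | h
    · simp at hB2
      rcases hB2 with h | h <;> omega
    · exact h
  have h8 : k * t < 8 * B ^ 3 := by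
    calc k * t < (B + 1) ^ 3 := hB2
      _ ≤ (2 * B) ^ 3 := Nat.pow_le_pow_left (by omega) 3
      _ = 8 * B ^ 3 := by ring
  have hBk : 4 * k ≤ B ^ 2 := by
    by_contra hcon
    have hcon := not_le.mp hcon
    have h1 : (B ^ 2) ^ 3 ≤ (4 * k) ^ 3 := Nat.pow_le_pow_left hcon.le 3
    have h2 : (k * t) ^ 2 < (8 * B ^ 3) ^ 2 := Nat.pow_lt_pow_left h8 (by norm_num)
    have h3 : k ^ 2 * t ^ 2 < k ^ 2 * (4096 * k) := by
      calc k ^ 2 * t ^ 2 = (k * t) ^ 2 := by ring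
        _ < (8 * B ^ 3) ^ 2 := h2
        _ = 64 * (B ^ 2) ^ 3 := by ring
        _ ≤ 64 * (4 * k) ^ 3 := Nat.mul_le_mul_left _ h1
        _ = k ^ 2 * (4096 * k) := by ring
    have h4 := lt_of_mul_lt_mul_left h3 (Nat.zero_le _)
    nlinarith
  set A := B ^ 2 / (4 * k) with hA
  have hApos : 0 < A := Nat.div_pos hBk (by omega)
  have hA1 : 4 * k * A ≤ B ^ 2 := Nat.mul_div_le _ _
  have hA2 : B ^ 2 ≤ 8 * k * A := by
    have : B ^ 2 < 4 * k * (A + 1) := Nat.lt_mul_div_succ _ (by omega)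
    nlinarith
  have hkA : 0 < k * A := Nat.mul_pos hk1 hApos
  have hst := stepanov t A B Λ S hS (by rw [← hk]; nlinarith) hApos (by
      have h1 : k * (A * B) ≤ k * t := by
        calc k * (A * B) ≤ 4 * k * A * B := by nlinarith
          _ ≤ B ^ 2 * B := Nat.mul_le_mul_right _ hA1
          _ = B ^ 3 := by ring
          _ ≤ _ := hB1
      exact le_of_mul_le_mul_left h1 hk1) (by
      have : (B * t) ^ 3 ≤ p ^ 3 := by
        calc (B * t) ^ 3 = B ^ 3 * t ^ 3 := by ring
          _ ≤ k * t * t ^ 3 := Nat.mul_le_mul_right _ hB1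
          _ = k * t ^ 4 := by ring
          _ ≤ _ := hkp
      exact le_of_pow_le_pow_left₀ (by norm_num) (Nat.zero_le _) this)
  have hnB : n * B ≤ 16 * t := by
    have : B * (n * B) ≤ B * (16 * t) := by
      calc B * (n * B) = n * B ^ 2 := by ring
        _ ≤ n * (8 * k * A) := Nat.mul_le_mul_left _ hA2
        _ = 8 * (A * (n * k)) := by ring
        _ ≤ 8 * (A * S.card) := by gcongr
        _ ≤ 8 * (2 * B * t) := by gcongr
        _ = _ := by ring
    exact le_of_mul_le_mul_left this hBpos
  have : t * (n ^ 3 * k) ≤ t * (32768 * t ^ 2) := by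
    calc t * (n ^ 3 * k) = n ^ 3 * (k * t) := by ring
      _ ≤ n ^ 3 * (8 * B ^ 3) := Nat.mul_le_mul_left _ h8.le
      _ = 8 * (n * B) ^ 3 := by ring
      _ ≤ 8 * (16 * t) ^ 3 := by gcongr
      _ = _ := by ring
  exact le_of_mul_le_mul_left this (by omega)

theorem st_arith (p t n k : ℕ) (ht : 1 ≤ t) (htp : t ^ 3 ≤ p ^ 2)
    (h1 : n ^ 3 * k ≤ 32768 * t ^ 2) (h2 : p ^ 3 ≤ 2 * k * t ^ 4) : n ^ 2 ≤ 2048 * t := by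
  by_contra hcon
  have hcon := not_le.mp hcon
  have a1 : n ^ 3 * p ^ 3 ≤ 65536 * t ^ 6 := by
    calc n ^ 3 * p ^ 3 ≤ n ^ 3 * (2 * k * t ^ 4) := Nat.mul_le_mul_left _ h2
      _ = 2 * t ^ 4 * (n ^ 3 * k) := by ring
      _ ≤ 2 * t ^ 4 * (32768 * t ^ 2) := Nat.mul_le_mul_left _ h1
      _ = _ := by ring
  have a2 : (2048 * t) ^ 3 ≤ (n ^ 2) ^ 3 := Nat.pow_le_pow_left hcon.le 3
  have a3 : (t ^ 3) ^ 3 ≤ (p ^ 2) ^ 3 := Nat.pow_le_pow_left htp 3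
  have a4 : (n ^ 3 * p ^ 3) ^ 2 ≤ (65536 * t ^ 6) ^ 2 := Nat.pow_le_pow_left a1 2
  have a5 : (2048 * t) ^ 3 * (t ^ 3) ^ 3 ≤ (65536 * t ^ 6) ^ 2 := by
    calc _ ≤ (n ^ 2) ^ 3 * (p ^ 2) ^ 3 := Nat.mul_le_mul a2 a3
      _ = (n ^ 3 * p ^ 3) ^ 2 := by ring
      _ ≤ _ := a4
  have : 0 < t ^ 12 := by positivity
  ring_nf at a5
  omega

theorem roots_card {p : ℕ} [Fact p.Prime] (t : ℕ) (l : ZMod p) (ht : 0 < t) :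
    (Finset.univ.filter (fun x : ZMod p => x ^ t = l)).card ≤ t := by
  refine le_trans (Finset.card_le_card ?_) ((Multiset.toFinset_card_le _).trans
    (Polynomial.card_nthRoots t l))
  intro x hx
  rw [Multiset.mem_toFinset, Polynomial.mem_nthRoots ht]
  simpa using hx

theorem level_bound_s16 {p : ℕ} [Fact p.Prime] (R : Finset (ZMod p)) (h0 : (0 : ZMod p) ∉ R)
    (hpow : ∀ a ∈ R, a ^ R.card = 1) (ht : 4096 ≤ R.card) (htp : R.card ^ 3 ≤ p ^ 2)
    (n : ℕ) (hn : 1 ≤ n) :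
    n ^ 3 * (Finset.univ.filter (fun s : ZMod p => s ≠ 0 ∧
      n ≤ (R ∩ R.image (fun a => a - s)).card)).card ≤ 32768 * R.card ^ 3 := by
  set t := R.card with htdef
  set Q := Finset.univ.filter (fun s : ZMod p => s ≠ 0 ∧
      n ≤ (R ∩ R.image (fun a => a - s)).card) with hQ
  set Λ := Q.image (fun s => (s⁻¹) ^ t) with hΛ
  let S : Finset (ZMod p) → Finset (ZMod p) := fun M =>
    Finset.univ.filter (fun y => y ≠ 0 ∧ y + 1 ≠ 0 ∧ y ^ t ∈ M ∧ (y + 1) ^ t = y ^ t)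
  have hSspec : ∀ M, ∀ y ∈ S M, y ≠ 0 ∧ y + 1 ≠ 0 ∧ y ^ t ∈ M ∧ (y + 1) ^ t = y ^ t := by
    intro M y hy
    simpa [S] using hy
  have hSlow : ∀ M ⊆ Λ, n * M.card ≤ (S M).card := by
    intro M hM
    rw [Finset.card_eq_sum_card_fiberwise (f := fun y => y ^ t) (t := M)
      (fun y hy => (hSspec M y hy).2.2.1)]
    rw [mul_comm, ← smul_eq_mul]
    apply Finset.card_nsmul_le_sum
    intro l hl
    obtain ⟨s, hs, hsl⟩ := Finset.mem_image.mp (hM hl)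
    obtain ⟨hs0, hsn⟩ : s ≠ 0 ∧ n ≤ (R ∩ R.image (fun a => a - s)).card := by
      simpa [hQ] using hs
    refine hsn.trans ?_
    rw [← Finset.card_image_of_injective _ (mul_left_injective₀ (inv_ne_zero hs0))]
    apply Finset.card_le_card
    intro y hy
    obtain ⟨a, ha, rfl⟩ := Finset.mem_image.mp hy
    obtain ⟨ha1, ha2⟩ := Finset.mem_inter.mp ha
    obtain ⟨b, hb, hba⟩ := Finset.mem_image.mp ha2
    have hb' : a * s⁻¹ + 1 = b * s⁻¹ := by
      rw [← hba]; field_simp; ring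
    have hane : a ≠ 0 := fun h => h0 (h ▸ ha1)
    have hbne : b ≠ 0 := fun h => h0 (h ▸ hb)
    have e1 : (a * s⁻¹) ^ t = l := by rw [mul_pow, hpow a ha1, one_mul]; exact hsl
    have e2 : (b * s⁻¹) ^ t = l := by rw [mul_pow, hpow b hb, one_mul]; exact hsl
    simp only [S, Finset.mem_filter, Finset.mem_univ, true_and]
    rw [hb', e1, e2]
    exact ⟨⟨mul_ne_zero hane (inv_ne_zero hs0), mul_ne_zero hbne (inv_ne_zero hs0), hl, rfl⟩, rfl⟩
  have hSup : (S Λ).card ≤ t := by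
    refine le_trans ?_ (roots_card t (1 : ZMod p) (by omega))
    apply Finset.card_le_card_of_injOn (fun y => (y + 1) * y⁻¹)
    · intro y hy
      obtain ⟨h1, h2, h3, h4⟩ := hSspec _ y hy
      simp only [Finset.coe_filter, Finset.mem_univ, true_and, Set.mem_setOf_eq]
      rw [mul_pow, h4, ← mul_pow, mul_inv_cancel₀ h1, one_pow]
    · intro y hy z hz hyz
      have h1 := (hSspec _ y hy).1
      have h2 := (hSspec _ z hz).1
      simp only at hyz
      field_simp at hyz
      linear_combination -hyz
  have hnk : n * Λ.card ≤ t := (hSlow Λ subset_rfl).trans hSup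
  have hkt : Λ.card ≤ t := le_trans (Nat.le_mul_of_pos_left _ hn) hnk
  have hQk : Q.card ≤ t * Λ.card := by
    apply Finset.card_le_mul_card_image
    intro l _
    refine le_trans ?_ (roots_card t l (by omega))
    apply Finset.card_le_card_of_injOn (fun s => s⁻¹)
    · intro s hs
      simp only [Finset.coe_filter, Set.mem_setOf_eq] at hs
      simpa using hs.2
    · exact inv_injective.injOn
  rcases Nat.eq_zero_or_pos Λ.card with hk0 | hkpos
  · rw [hk0, mul_zero] at hQk
    rw [Nat.le_zero.mp hQk]; simp
  by_cases hc : Λ.card * t ^ 4 ≤ p ^ 3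
  · have := st_param t n Λ (S Λ) (hSspec Λ) ht hkpos hkt hc (hSlow Λ subset_rfl)
    calc n ^ 3 * Q.card ≤ n ^ 3 * (t * Λ.card) := Nat.mul_le_mul_left _ hQk
      _ = t * (n ^ 3 * Λ.card) := by ring
      _ ≤ t * (32768 * t ^ 2) := Nat.mul_le_mul_left _ this
      _ = _ := by ring
  · have hc := not_le.mp hc
    have ht4 : 0 < t ^ 4 := by positivity
    have h43 : t ^ 4 ≤ p ^ 3 := by
      have : (t ^ 4) ^ 2 ≤ (p ^ 3) ^ 2 := by
        calc (t ^ 4) ^ 2 = t ^ 8 := by ring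
          _ ≤ t ^ 9 := Nat.pow_le_pow_right (by omega) (by norm_num)
          _ = (t ^ 3) ^ 3 := by ring
          _ ≤ (p ^ 2) ^ 3 := Nat.pow_le_pow_left htp 3
          _ = _ := by ring
      exact le_of_pow_le_pow_left₀ (by norm_num) (Nat.zero_le _) this
    set k' := p ^ 3 / t ^ 4 with hk'
    have hk'1 : 1 ≤ k' := Nat.div_pos h43 ht4
    have hk'2 : k' * t ^ 4 ≤ p ^ 3 := Nat.div_mul_le_self _ _
    have hk'3 : p ^ 3 ≤ 2 * k' * t ^ 4 := by
      have : p ^ 3 < t ^ 4 * (k' + 1) := Nat.lt_mul_div_succ _ ht4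
      nlinarith
    have hk'4 : k' ≤ Λ.card := by
      have : k' * t ^ 4 ≤ Λ.card * t ^ 4 := hk'2.trans hc.le
      exact le_of_mul_le_mul_right this ht4
    obtain ⟨M, hM, hMc⟩ := Finset.exists_subset_card_eq hk'4
    have := st_param t n M (S M) (hSspec M) ht (by omega) (by omega) (by rw [hMc]; exact hk'2)
      (hSlow M hM)
    rw [hMc] at this
    have hn2 := st_arith p t n k' (by omega) htp this hk'3
    calc n ^ 3 * Q.card ≤ n ^ 3 * (t * Λ.card) := Nat.mul_le_mul_left _ hQk
      _ = n ^ 2 * t * (n * Λ.card) := by ring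
      _ ≤ (2048 * t) * t * t := by gcongr
      _ ≤ _ := by nlinarith [Nat.zero_le (t ^ 3)]

theorem cube_le_sum (x : ℕ) : (x : ℝ) ^ 3 ≤ ∑ n ∈ Finset.Icc 1 x, 3 * (n : ℝ) ^ 2 := by
  induction x with
  | zero => simp
  | succ x ih =>
    rw [Finset.sum_Icc_succ_top (by omega)]
    push_cast
    have : (0 : ℝ) ≤ x := by positivity
    nlinarith

theorem large_case {p : ℕ} [Fact p.Prime] (R : Finset (ZMod p)) (h0 : (0 : ZMod p) ∉ R)
    (hpow : ∀ a ∈ R, a ^ R.card = 1) (ht : 4096 ≤ R.card) (htp : R.card ^ 3 ≤ p ^ 2) :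
    ∑ s : ZMod p, ((R ∩ R.image (fun a => a - s)).card : ℝ) ^ 3 ≤
      (R.card : ℝ) ^ 3 + 98304 * (R.card : ℝ) ^ 3 * (1 + Real.log R.card) := by
  set t := R.card with htdef
  set f : ZMod p → ℕ := fun s => (R ∩ R.image (fun a => a - s)).card with hf
  have hft : ∀ s, f s ≤ t := fun s => Finset.card_le_card Finset.inter_subset_left
  change ∑ s : ZMod p, (f s : ℝ) ^ 3 ≤ _
  rw [← Finset.add_sum_erase _ _ (Finset.mem_univ (0 : ZMod p))]
  apply add_le_add
  · exact pow_le_pow_left₀ (by positivity) (by exact_mod_cast hft 0) 3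
  · have h1 : ∀ s, (f s : ℝ) ^ 3 ≤ ∑ n ∈ Finset.Icc 1 t, if n ≤ f s then 3 * (n : ℝ) ^ 2 else 0 := by
      intro s
      refine (cube_le_sum (f s)).trans (le_of_eq ?_)
      rw [← Finset.sum_filter]
      apply Finset.sum_congr _ (fun _ _ => rfl)
      ext n
      have := hft s
      simp only [Finset.mem_Icc, Finset.mem_filter]
      omega
    calc ∑ s ∈ Finset.univ.erase (0 : ZMod p), (f s : ℝ) ^ 3
        ≤ ∑ s ∈ Finset.univ.erase (0 : ZMod p),
          ∑ n ∈ Finset.Icc 1 t, (if n ≤ f s then 3 * (n : ℝ) ^ 2 else 0) :=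
          Finset.sum_le_sum (fun s _ => h1 s)
      _ = ∑ n ∈ Finset.Icc 1 t, ∑ s ∈ Finset.univ.erase (0 : ZMod p),
          (if n ≤ f s then 3 * (n : ℝ) ^ 2 else 0) := Finset.sum_comm
      _ ≤ ∑ n ∈ Finset.Icc 1 t, 98304 * (t : ℝ) ^ 3 * (n : ℝ)⁻¹ := by
          apply Finset.sum_le_sum
          intro n hn
          have hn1 : 1 ≤ n := (Finset.mem_Icc.mp hn).1
          have hb := level_bound_s16 R h0 hpow ht htp n hn1
          rw [← Finset.sum_filter, Finset.sum_const, nsmul_eq_mul]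
          have he : (Finset.univ.erase (0 : ZMod p)).filter (fun s => n ≤ f s)
              = Finset.univ.filter (fun s : ZMod p => s ≠ 0 ∧
                n ≤ (R ∩ R.image (fun a => a - s)).card) := by
            ext s; simp [hf]
          rw [he]
          have hb' : (n : ℝ) ^ 3 * ((Finset.univ.filter (fun s : ZMod p => s ≠ 0 ∧
                n ≤ (R ∩ R.image (fun a => a - s)).card)).card : ℝ) ≤ 32768 * (t : ℝ) ^ 3 := by
            exact_mod_cast hb
          have hnpos : (0 : ℝ) < n := by exact_mod_cast hn1
          rw [← div_eq_mul_inv, le_div_iff₀ hnpos]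
          linarith
      _ = 98304 * (t : ℝ) ^ 3 * ∑ n ∈ Finset.Icc 1 t, (n : ℝ)⁻¹ := by rw [Finset.mul_sum]
      _ ≤ _ := by
          have := harmonic_le_one_add_log t
          rw [harmonic_eq_sum_Icc] at this
          push_cast at this
          gcongr

theorem small_case {p : ℕ} [Fact p.Prime] (R : Finset (ZMod p)) :
    ∑ s : ZMod p, ((R ∩ R.image (fun a => a - s)).card : ℝ) ^ 3 ≤ (R.card : ℝ) ^ 5 := by
  have hsub : ∑ s : ZMod p, ((R ∩ R.image (fun a => a - s)).card : ℝ) ^ 3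
      = ∑ s ∈ (R ×ˢ R).image (fun x => x.1 - x.2), ((R ∩ R.image (fun a => a - s)).card : ℝ) ^ 3 := by
    symm
    apply Finset.sum_subset (Finset.subset_univ _)
    intro s _ hs
    have : R ∩ R.image (fun a => a - s) = ∅ := by
      rw [Finset.eq_empty_iff_forall_notMem]
      intro a ha
      obtain ⟨ha1, ha2⟩ := Finset.mem_inter.mp ha
      obtain ⟨b, hb, rfl⟩ := Finset.mem_image.mp ha2
      exact hs (Finset.mem_image.mpr ⟨(b, b - s), Finset.mem_product.mpr ⟨hb, ha1⟩, by simp⟩)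
    rw [this]; simp
  rw [hsub]
  have hcard : ((R ×ˢ R).image (fun x => x.1 - x.2)).card ≤ R.card * R.card :=
    Finset.card_image_le.trans (by rw [Finset.card_product])
  calc _ ≤ ∑ s ∈ (R ×ˢ R).image (fun x => x.1 - x.2), (R.card : ℝ) ^ 3 := by
        apply Finset.sum_le_sum
        intro s _
        apply pow_le_pow_left₀ (by positivity)
        exact_mod_cast Finset.card_le_card Finset.inter_subset_left
    _ = (((R ×ˢ R).image (fun x => x.1 - x.2)).card : ℝ) * (R.card : ℝ) ^ 3 := by
        rw [Finset.sum_const, nsmul_eq_mul]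
    _ ≤ ((R.card * R.card : ℕ) : ℝ) * (R.card : ℝ) ^ 3 := by
        gcongr
    _ = _ := by push_cast; ring

theorem subgroup_E3_bound :
    ∃ c C : ℝ, 0 < c ∧ 0 < C ∧
      ∀ (p : ℕ) [Fact p.Prime],
        ∀ R : Finset (ZMod p), IsMulSubgroup p R →
          2 ≤ R.card →
          (R.card : ℝ) ≤ c * (p : ℝ) ^ ((2 : ℝ) / 3) →
          ∑ s : ZMod p, ((R ∩ R.image (fun a => a - s)).card : ℝ) ^ 3 ≤
            C * (R.card : ℝ) ^ 3 * Real.logb 2 (R.card : ℝ) := by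
  refine ⟨1, 20000000, by norm_num, by norm_num, ?_⟩
  intro p _ R hR h2 hle
  have h2' : (2 : ℝ) ≤ R.card := by exact_mod_cast h2
  have hlog1 : 1 ≤ Real.logb 2 (R.card : ℝ) := by
    rw [Real.le_logb_iff_rpow_le (by norm_num) (by linarith)]
    simpa using h2'
  have hloglog : Real.log R.card ≤ Real.logb 2 (R.card : ℝ) := by
    rw [Real.logb, le_div_iff₀ (Real.log_pos (by norm_num))]
    have h3 : 0 ≤ Real.log R.card := Real.log_nonneg (by linarith)
    have h4 := Real.log_two_lt_d9
    nlinarith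
  have ht3 : 0 ≤ (R.card : ℝ) ^ 3 := by positivity
  rcases lt_or_ge R.card 4096 with hsm | hbig
  · refine (small_case R).trans ?_
    have h5 : (R.card : ℝ) ≤ 4096 := by exact_mod_cast hsm.le
    have h6 : (R.card : ℝ) ^ 2 ≤ 4096 ^ 2 := pow_le_pow_left₀ (by positivity) h5 2
    calc (R.card : ℝ) ^ 5 = (R.card : ℝ) ^ 3 * (R.card : ℝ) ^ 2 := by ring
      _ ≤ (R.card : ℝ) ^ 3 * 20000000 := by
        apply mul_le_mul_of_nonneg_left _ ht3
        linarith
      _ = 20000000 * (R.card : ℝ) ^ 3 * 1 := by ring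
      _ ≤ _ := by gcongr
  · obtain ⟨H, hH⟩ := hR
    have hmem : ∀ a, a ∈ R ↔ ∃ h ∈ H, (h : ZMod p) = a := by
      intro a
      rw [← Finset.mem_coe, hH]
      rfl
    have hcard : R.card = Nat.card H := by
      rw [← Set.ncard_coe_finset, hH, Set.ncard_image_of_injective _ Units.val_injective]
      rfl
    have h0 : (0 : ZMod p) ∉ R := by
      intro h
      obtain ⟨u, _, hu⟩ := (hmem 0).mp h
      exact u.ne_zero hu
    have hpow : ∀ a ∈ R, a ^ R.card = 1 := by
      intro a ha
      obtain ⟨u, hu, rfl⟩ := (hmem a).mp ha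
      have h1 : (⟨u, hu⟩ : H) ^ Nat.card H = 1 := pow_card_eq_one'
      have h2 : u ^ Nat.card H = 1 := congrArg Subtype.val h1
      rw [hcard, ← Units.val_pow_eq_pow_val, h2, Units.val_one]
    have htp : R.card ^ 3 ≤ p ^ 2 := by
      have h1 : (R.card : ℝ) ^ 3 ≤ ((p : ℝ) ^ ((2 : ℝ) / 3)) ^ 3 :=
        pow_le_pow_left₀ (by positivity) (by linarith) 3
      have h2 : ((p : ℝ) ^ ((2 : ℝ) / 3)) ^ 3 = (p : ℝ) ^ 2 := by
        rw [← Real.rpow_natCast, ← Real.rpow_mul (by positivity)]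
        norm_num
      rw [h2] at h1
      exact_mod_cast h1
    refine (large_case R h0 hpow hbig htp).trans ?_
    set x := (R.card : ℝ) ^ 3
    set l := Real.logb 2 (R.card : ℝ)
    have h7 : x * 1 ≤ x * l := mul_le_mul_of_nonneg_left hlog1 ht3
    have h8 : x * Real.log R.card ≤ x * l := mul_le_mul_of_nonneg_left hloglog ht3
    nlinarith
end

section
/- There exist constants c > 0 and C > 0 such that for every prime p and every multiplicative subgroup R ⊆ F_p* with |R| ≤ c·p^{2/3}, one has E₄(R) ≤ |R|⁴ + C·|R|^{11/3}. -/
open Finset Pointwise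

open Polynomial in
/-- A sparse polynomial of degree `< p` cannot vanish to high order at `1`. -/
lemma sparse_eq_zero (p : ℕ) [Fact p.Prime] : ∀ (N : ℕ) (H : (ZMod p)[X]),
    H.support.card ≤ N → H.natDegree < p → (X - 1) ^ N ∣ H → H = 0 := by
  intro N
  induction N with
  | zero =>
    intro H h _ _
    simpa using h
  | succ N ih =>
    intro H hc hd hdiv
    by_contra hne
    obtain ⟨e, he⟩ := (Polynomial.nonempty_support_iff).2 hne
    have hcoeff : ∀ n : ℕ, (X * derivative H - C (e : ZMod p) * H).coeff n
        = ((n : ZMod p) - e) * H.coeff n := by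
      intro n
      rw [coeff_sub, coeff_C_mul]
      cases n with
      | zero => simp
      | succ n => rw [coeff_X_mul, coeff_derivative]; push_cast; ring
    have hz : X * derivative H - C (e : ZMod p) * H = 0 := by
      apply ih
      · have : (X * derivative H - C (e : ZMod p) * H).support ⊆ H.support.erase e := by
          intro n hn
          rw [mem_support_iff, hcoeff] at hn
          rw [Finset.mem_erase, mem_support_iff]
          refine ⟨?_, right_ne_zero_of_mul hn⟩
          rintro rfl
          simp at hn
        have h1 := Finset.card_le_card this
        rw [Finset.card_erase_of_mem he] at h1
        omega
      · refine lt_of_le_of_lt ?_ hd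
        rw [natDegree_le_iff_coeff_eq_zero]
        intro n hn
        rw [hcoeff, coeff_eq_zero_of_natDegree_lt hn, mul_zero]
      · obtain ⟨g, rfl⟩ := hdiv
        have : derivative ((X - 1 : (ZMod p)[X]) ^ (N + 1) * g)
            = (X - 1) ^ N * (((N : (ZMod p)[X]) + 1) * g + (X - 1) * derivative g) := by
          rw [derivative_mul, derivative_pow_succ]
          simp
          ring
        rw [this]
        exact ⟨X * (((N : (ZMod p)[X]) + 1) * g + (X - 1) * derivative g)
          - C (e : ZMod p) * ((X - 1) * g), by ring⟩
    have hH : H = monomial e (H.coeff e) := by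
      ext n
      rw [coeff_monomial]
      split_ifs with h
      · rw [h]
      · have := hcoeff n
        rw [hz, coeff_zero] at this
        rcases mul_eq_zero.1 this.symm with h1 | h1
        · by_contra h2
          apply h
          have hn : n < p := lt_of_le_of_lt (le_natDegree_of_ne_zero h2) hd
          have he' : e < p := lt_of_le_of_lt (le_natDegree_of_mem_supp _ he) hd
          have h3 := (ZMod.natCast_eq_natCast_iff' n e p).1 (sub_eq_zero.1 h1)
          rw [Nat.mod_eq_of_lt hn, Nat.mod_eq_of_lt he'] at h3
          exact h3.symm
        · exact h1
    have h1 : H.eval 1 = 0 := by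
      obtain ⟨g, hg⟩ := hdiv
      rw [hg]
      simp
    rw [hH] at h1
    simp at h1
    exact (mem_support_iff.1 he) h1

open Polynomial in
lemma nonvanish (p : ℕ) [Fact p.Prime] (t : ℕ) : ∀ (B : ℕ) (H : ℕ → (ZMod p)[X]),
    (∀ b, (H b).support.card ≤ t) → (∀ b, (H b).natDegree < p) →
    ∑ b ∈ Finset.range B, H b * (X - 1) ^ (t * b) = 0 → ∀ b < B, H b = 0 := by
  intro B
  induction B with
  | zero => intro H _ _ _ b hb; omega
  | succ B ih =>
    intro H h1 h2 hs
    rw [Finset.sum_range_succ'] at hs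
    have he : ∑ b ∈ Finset.range B, H (b + 1) * (X - 1) ^ (t * (b + 1))
        = (X - 1) ^ t * ∑ b ∈ Finset.range B, H (b + 1) * (X - 1) ^ (t * b) := by
      rw [Finset.mul_sum]
      refine Finset.sum_congr rfl fun b _ => ?_
      ring
    rw [he] at hs
    have h0 : H 0 = 0 := by
      apply sparse_eq_zero p t _ (h1 0) (h2 0)
      refine ⟨- ∑ b ∈ Finset.range B, H (b + 1) * (X - 1) ^ (t * b), ?_⟩
      simp only [mul_zero, pow_zero, mul_one] at hs
      linear_combination hs
    rw [h0, zero_mul, add_zero] at hs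
    have hX : (X - 1 : (ZMod p)[X]) ≠ 0 := by
      have := X_sub_C_ne_zero (1 : ZMod p)
      simpa using this
    have hs' := (mul_eq_zero.1 hs).resolve_left (pow_ne_zero _ hX)
    have := ih (fun b => H (b + 1)) (fun b => h1 _) (fun b => h2 _) hs'
    intro b hb
    cases b with
    | zero => exact h0
    | succ b => exact this b (by omega)

open Polynomial in
/-- The derivation `X (X - 1) d/dX`. -/
noncomputable def del (p : ℕ) (f : (ZMod p)[X]) : (ZMod p)[X] := X * (X - 1) * derivative f

open Polynomial in
lemma dvd_of_del (p : ℕ) [Fact p.Prime] (y : ZMod p) (hy : y ≠ 0) (hy1 : y - 1 ≠ 0) :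
    ∀ (D : ℕ), D ≤ p → ∀ f : (ZMod p)[X], (∀ n < D, ((del p)^[n] f).eval y = 0) →
      (X - C y) ^ D ∣ f := by
  intro D
  induction D with
  | zero => intro _ f _; simp
  | succ D ih =>
    intro hD f hf
    obtain ⟨g, hg⟩ := ih (by omega) f (fun n hn => hf n (by omega))
    have hd : (X - C y) ^ D ∣ del p f := by
      apply ih (by omega)
      intro n hn
      have := hf (n + 1) (by omega)
      rwa [Function.iterate_succ_apply] at this
    suffices h : g.eval y = 0 by
      obtain ⟨k, hk⟩ := dvd_iff_isRoot.2 h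
      exact ⟨k, by rw [hg, hk]; ring⟩
    cases D with
    | zero =>
      have := hf 0 (by omega)
      simpa [hg] using this
    | succ D =>
      obtain ⟨k, hk⟩ := hd
      have hX : (X - C y) ^ D ≠ 0 := pow_ne_zero _ (X_sub_C_ne_zero y)
      have h1 : del p f = (X - C y) ^ D *
          (X * (X - 1) * (((D : (ZMod p)[X]) + 1) * g + (X - C y) * derivative g)) := by
        rw [del, hg, derivative_mul, derivative_pow_succ]
        simp
        ring
      rw [h1, pow_succ, mul_assoc ((X - C y) ^ D) (X - C y) k] at hk
      have hk2 := congrArg (eval y) (mul_left_cancel₀ hX hk)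
      simp [hy, hy1] at hk2
      rcases hk2 with h2 | h2
      · exfalso
        have h3 : ((D + 1 : ℕ) : ZMod p) = 0 := by push_cast; exact h2
        rw [ZMod.natCast_eq_zero_iff] at h3
        have := Nat.le_of_dvd (by omega) h3
        omega
      · exact h2

open Polynomial in
/-- Polynomial factor in the iterated derivation of `X^(a+tc) (X-1)^(tb)`. -/
noncomputable def PP (p t a b c : ℕ) : ℕ → (ZMod p)[X]
  | 0 => X ^ a
  | n + 1 => X * (X - 1) * derivative (PP p t a b c n)
      + (C ((t * c : ℕ) : ZMod p) * (X - 1) + C ((t * b : ℕ) : ZMod p) * X) * PP p t a b c n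

open Polynomial in
lemma PP_natDegree (p : ℕ) [Fact p.Prime] (t a b c n : ℕ) :
    (PP p t a b c n).natDegree ≤ a + n := by
  induction n with
  | zero => simp [PP]
  | succ n ih =>
    rw [PP]
    have hX1 : (X - 1 : (ZMod p)[X]).natDegree ≤ 1 := by
      simpa using natDegree_X_sub_C_le (1 : ZMod p)
    apply natDegree_add_le_of_degree_le
    · by_cases h0 : derivative (PP p t a b c n) = 0
      · simp [h0]
      by_cases h1 : (PP p t a b c n).natDegree = 0
      · exact absurd (derivative_of_natDegree_zero h1) h0
      have hlt := natDegree_derivative_lt h1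
      refine (natDegree_mul_le).trans ?_
      have : (X * (X - 1) : (ZMod p)[X]).natDegree ≤ 1 + 1 :=
        natDegree_mul_le_of_le natDegree_X_le hX1
      omega
    · refine (natDegree_mul_le).trans ?_
      have : (C ((t * c : ℕ) : ZMod p) * (X - 1) + C ((t * b : ℕ) : ZMod p) * X).natDegree ≤ 1 := by
        apply natDegree_add_le_of_degree_le
        · exact (natDegree_C_mul_le _ _).trans hX1
        · exact (natDegree_C_mul_le _ _).trans natDegree_X_le
      omega

open Polynomial in
lemma derivative_pow_mul_self {F : Type*} [CommRing F] (q : F[X]) (m : ℕ) :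
    q * derivative (q ^ m) = (m : F[X]) * q ^ m * derivative q := by
  cases m with
  | zero => simp
  | succ m => rw [derivative_pow_succ]; simp; ring

open Polynomial in
lemma del_iter (p : ℕ) [Fact p.Prime] (t a b c n : ℕ) :
    (del p)^[n] (X ^ (t * c + a) * (X - 1) ^ (t * b))
      = PP p t a b c n * X ^ (t * c) * (X - 1) ^ (t * b) := by
  induction n with
  | zero => simp only [PP, Function.iterate_zero, id]; ring
  | succ n ih =>
    rw [Function.iterate_succ_apply', ih, del, PP, derivative_mul, derivative_mul]
    have h1 := derivative_pow_mul_self (X : (ZMod p)[X]) (t * c)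
    have h2 := derivative_pow_mul_self (X - 1 : (ZMod p)[X]) (t * b)
    simp only [derivative_X, derivative_sub, derivative_one, sub_zero, mul_one] at h1 h2
    simp only [map_natCast]
    linear_combination (PP p t a b c n * (X - 1) * (X - 1) ^ (t * b)) * h1
      + (PP p t a b c n * X * X ^ (t * c)) * h2

open Polynomial in
lemma del_iter_sum (p : ℕ) {ι : Type*} (s : Finset ι) (l : ι → ZMod p)
    (f : ι → (ZMod p)[X]) (n : ℕ) :
    (del p)^[n] (∑ i ∈ s, C (l i) * f i) = ∑ i ∈ s, C (l i) * (del p)^[n] (f i) := by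
  induction n with
  | zero => simp
  | succ n ih =>
    rw [Function.iterate_succ_apply', ih, del, derivative_sum, Finset.mul_sum]
    refine Finset.sum_congr rfl fun i _ => ?_
    rw [Function.iterate_succ_apply', del, derivative_C_mul]
    ring

/-- The set of `y` with `y^t = (y-1)^t = u`. -/
def SS (p : ℕ) [Fact p.Prime] (t : ℕ) (u : ZMod p) : Finset (ZMod p) :=
  Finset.univ.filter (fun y => y ^ t = u ∧ (y - 1) ^ t = u)

open Polynomial in
lemma coeffs_zero (p : ℕ) [Fact p.Prime] (t B D : ℕ) (hDt : D ≤ t)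
    (hDB : D * B ≤ t) (htB : t * B ≤ p) (l : Fin B × Fin B × Fin D → ZMod p)
    (h0 : ∑ i, C (l i) * (X ^ (t * (i.2.1 : ℕ) + i.2.2) * (X - 1) ^ (t * (i.1 : ℕ))) = 0) :
    l = 0 := by
  set e : Fin B × Fin D → ℕ := fun q => t * (q.1 : ℕ) + q.2 with he
  have hinj : Function.Injective e := by
    rintro ⟨c, a⟩ ⟨c', a'⟩ h
    have ha := a.2
    have ha' := a'.2
    simp only [he] at h
    have h1 := congrArg (· / t) h
    have h2 := congrArg (· % t) h
    simp only [Nat.mul_add_mod, Nat.mul_add_div (show 0 < t by omega),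
      Nat.div_eq_of_lt (show (a : ℕ) < t by omega), Nat.div_eq_of_lt (show (a' : ℕ) < t by omega),
      Nat.mod_eq_of_lt (show (a : ℕ) < t by omega), Nat.mod_eq_of_lt (show (a' : ℕ) < t by omega)]
      at h1 h2
    ext <;> simp <;> omega
  have hlt : ∀ q, e q < p := by
    rintro ⟨c, a⟩
    have ha := a.2
    have hc := c.2
    simp only [he]
    have : t * ((c : ℕ) + 1) ≤ t * B := Nat.mul_le_mul_left _ hc
    rw [mul_add] at this
    omega
  have hp : 0 < p := (Fact.out : p.Prime).pos
  set H : ℕ → (ZMod p)[X] := fun b => if h : b < B then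
    ∑ q : Fin B × Fin D, C (l (⟨b, h⟩, q)) * X ^ (e q) else 0 with hH
  have hcoeff : ∀ (b : Fin B) (m : ℕ), (H b).coeff m = ∑ q, if m = e q then l (b, q) else 0 := by
    intro b m
    simp only [hH, b.2, dif_pos, finsetSum_coeff, coeff_C_mul_X_pow]
  have key := nonvanish p t B H ?_ ?_ ?_
  · ext ⟨b, q⟩
    have h1 := hcoeff b (e q)
    rw [key b b.2] at h1
    simp only [coeff_zero] at h1
    rw [Finset.sum_eq_single q] at h1
    · simpa using h1.symm
    · intro q' _ hq
      rw [if_neg]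
      intro h
      exact hq (hinj h).symm
    · simp
  · intro b
    by_cases hb : b < B
    · have hsub : (H b).support ⊆ Finset.univ.image e := by
        intro m hm
        rw [mem_support_iff, hcoeff ⟨b, hb⟩ m] at hm
        obtain ⟨q, _, hq⟩ := Finset.exists_ne_zero_of_sum_ne_zero hm
        rw [Finset.mem_image]
        refine ⟨q, Finset.mem_univ _, ?_⟩
        by_contra hne
        exact hq (if_neg (fun h => hne h.symm))
      have := (Finset.card_le_card hsub).trans Finset.card_image_le
      simp at this
      nlinarith
    · simp [hH, hb]
  · intro b
    by_cases hb : b < B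
    · have : (H b).natDegree ≤ p - 1 := by
        simp only [hH, hb, dif_pos]
        apply natDegree_sum_le_of_forall_le
        intro q _
        refine (natDegree_C_mul_X_pow_le _ _).trans ?_
        have := hlt q
        omega
      omega
    · simp [hH, hb, hp]
  · rw [← h0, Finset.sum_range, Fintype.sum_prod_type]
    refine Finset.sum_congr rfl fun b _ => ?_
    simp only [hH, b.2, dif_pos, Finset.sum_mul]
    refine Finset.sum_congr rfl fun q _ => ?_
    simp only [he]
    ring

open Polynomial in
lemma stepanov_s17 (p : ℕ) [Fact p.Prime] (t B D : ℕ) (U : Finset (ZMod p)) (ht : 1 ≤ t)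
    (hD : 1 ≤ D) (hB : 1 ≤ B) (hDB : D * B ≤ t) (htB : t * B ≤ p) (hU : 0 ∉ U)
    (hk : U.card * (2 * D) < B ^ 2) :
    D * ∑ u ∈ U, (SS p t u).card < 2 * (t * B) := by
  have hDt : D ≤ t := by nlinarith
  have hDp : D ≤ p := by nlinarith
  let M : Matrix (U × Fin D × Fin (2 * D)) (Fin B × Fin B × Fin D) (ZMod p) := fun r i =>
    (r.1 : ZMod p) ^ ((i.1 : ℕ) + i.2.1) * (PP p t i.2.2 i.1 i.2.1 r.2.1).coeff r.2.2
  have hker : LinearMap.ker M.mulVecLin ≠ ⊥ := by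
    apply LinearMap.ker_ne_bot_of_finrank_lt
    simp only [Module.finrank_fintype_fun_eq_card, Fintype.card_prod, Fintype.card_fin,
      Fintype.card_coe]
    have := Nat.mul_lt_mul_of_pos_right hk hD
    nlinarith
  obtain ⟨l, hl, hl0⟩ := Submodule.exists_mem_ne_zero_of_ne_bot hker
  set Φ : (ZMod p)[X] :=
    ∑ i, C (l i) * (X ^ (t * (i.2.1 : ℕ) + i.2.2) * (X - 1) ^ (t * (i.1 : ℕ))) with hΦ
  have hΦ0 : Φ ≠ 0 := fun h => hl0 (coeffs_zero p t B D hDt hDB htB l h)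
  have hdeg : Φ.natDegree < 2 * (t * B) := by
    have : Φ.natDegree ≤ 2 * (t * B) - 1 := by
      apply natDegree_sum_le_of_forall_le
      rintro ⟨b, c, a⟩ _
      refine (natDegree_C_mul_le _ _).trans (natDegree_mul_le.trans ?_)
      rw [natDegree_X_pow]
      have hX1 : (X - 1 : (ZMod p)[X]).natDegree ≤ 1 := by
        simpa using natDegree_X_sub_C_le (1 : ZMod p)
      have h1 : ((X - 1 : (ZMod p)[X]) ^ (t * (b : ℕ))).natDegree ≤ t * b * 1 :=
        natDegree_pow_le_of_le _ hX1
      have ha := a.2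
      have hc : t * ((c : ℕ) + 1) ≤ t * B := Nat.mul_le_mul_left _ c.2
      have hb : t * ((b : ℕ) + 1) ≤ t * B := Nat.mul_le_mul_left _ b.2
      rw [mul_add] at hb hc
      simp only
      omega
    have : 1 ≤ t * B := Nat.mul_pos ht hB
    omega
  have hroot : ∀ u ∈ U, ∀ y ∈ SS p t u, (X - C y) ^ D ∣ Φ := by
    intro u hu y hy
    simp only [SS, Finset.mem_filter, Finset.mem_univ, true_and] at hy
    have hu0 : u ≠ 0 := fun h => hU (h ▸ hu)
    have hy0 : y ≠ 0 := by
      rintro rfl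
      rw [zero_pow (by omega)] at hy
      exact hu0 hy.1.symm
    have hy1 : y - 1 ≠ 0 := by
      intro h
      rw [h, zero_pow (by omega)] at hy
      exact hu0 hy.2.symm
    apply dvd_of_del p y hy0 hy1 D hDp
    intro n hn
    rw [hΦ, del_iter_sum]
    simp only [del_iter]
    have hQ : ∑ i, C (l i) * (C (u ^ ((i.1 : ℕ) + i.2.1)) * PP p t i.2.2 i.1 i.2.1 n) = 0 := by
      ext m
      simp only [finsetSum_coeff, coeff_C_mul, coeff_zero]
      by_cases hm : m < 2 * D
      · have := congrFun (LinearMap.mem_ker.1 hl) (⟨u, hu⟩, ⟨n, hn⟩, ⟨m, hm⟩)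
        simp only [M, Pi.zero_apply] at this
        rw [← this]
        exact Finset.sum_congr rfl fun i _ => mul_comm _ _
      · apply Finset.sum_eq_zero
        rintro ⟨b, c, a⟩ _
        have h1 := PP_natDegree p t a b c n
        have ha := a.2
        rw [coeff_eq_zero_of_natDegree_lt (by simp only; omega)]
        simp
    have hQ2 := congrArg (eval y) hQ
    rw [eval_finsetSum, eval_zero] at hQ2
    rw [eval_finsetSum, ← hQ2]
    refine Finset.sum_congr rfl fun i _ => ?_
    simp only [eval_mul, eval_C, eval_pow, eval_X, eval_sub, eval_one, pow_mul, hy.1, hy.2]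
    ring
  have hdisj : (U : Set (ZMod p)).PairwiseDisjoint (SS p t) := by
    intro u _ v _ huv
    rw [Function.onFun, Finset.disjoint_left]
    intro y h1 h2
    simp only [SS, Finset.mem_filter, Finset.mem_univ, true_and] at h1 h2
    exact huv (h1.1.symm.trans h2.1)
  have hprod : ∏ y ∈ U.biUnion (SS p t), (X - C y) ^ D ∣ Φ := by
    apply Finset.prod_dvd_of_coprime
    · intro x _ y _ hxy
      exact (pairwise_coprime_X_sub_C Function.injective_id hxy).pow
    · intro y hy
      obtain ⟨u, hu, hy⟩ := Finset.mem_biUnion.1 hy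
      exact hroot u hu y hy
  have h1 := natDegree_le_of_dvd hprod hΦ0
  rw [natDegree_prod_of_monic _ _ (fun y _ => (monic_X_sub_C y).pow D)] at h1
  simp only [natDegree_pow, natDegree_X_sub_C, mul_one, Finset.sum_const, smul_eq_mul] at h1
  rw [Finset.card_biUnion (fun u hu v hv h => hdisj hu hv h)] at h1
  rw [mul_comm]
  omega

lemma card_pow_eq_le (p : ℕ) [Fact p.Prime] (t : ℕ) (ht : 1 ≤ t) (u : ZMod p) :
    (Finset.univ.filter (fun z : ZMod p => z ^ t = u)).card ≤ t := by
  have hsub : Finset.univ.filter (fun z : ZMod p => z ^ t = u)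
      ⊆ (Polynomial.nthRoots t u).toFinset := by
    intro z hz
    rw [Multiset.mem_toFinset, Polynomial.mem_nthRoots (by omega)]
    simpa using hz
  exact (Finset.card_le_card hsub).trans
    ((Multiset.toFinset_card_le _).trans (Polynomial.card_nthRoots t u))

lemma sum_SS_le (p : ℕ) [Fact p.Prime] (t : ℕ) (ht : 1 ≤ t) (U : Finset (ZMod p)) (hU : 0 ∉ U) :
    ∑ u ∈ U, (SS p t u).card ≤ t := by
  have hdisj : (U : Set (ZMod p)).PairwiseDisjoint (SS p t) := by
    intro u _ v _ huv
    rw [Function.onFun, Finset.disjoint_left]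
    intro y h1 h2
    simp only [SS, Finset.mem_filter, Finset.mem_univ, true_and] at h1 h2
    exact huv (h1.1.symm.trans h2.1)
  rw [← Finset.card_biUnion (fun u hu v hv h => hdisj hu hv h)]
  refine le_trans ?_ (card_pow_eq_le p t ht 1)
  have hprop : ∀ y ∈ U.biUnion (SS p t), y - 1 ≠ 0 ∧ y ^ t = (y - 1) ^ t := by
    intro y hy
    obtain ⟨u, hu, hy⟩ := Finset.mem_biUnion.1 hy
    simp only [SS, Finset.mem_filter, Finset.mem_univ, true_and] at hy
    refine ⟨?_, hy.1.trans hy.2.symm⟩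
    intro h
    rw [h, zero_pow (by omega)] at hy
    exact hU (hy.2 ▸ hu)
  apply Finset.card_le_card_of_injOn (fun y => y / (y - 1))
  · intro y hy
    obtain ⟨h1, h2⟩ := hprop y hy
    simp only [Finset.coe_filter, Finset.mem_univ, true_and, Set.mem_ofPred_eq]
    rw [div_pow, h2, div_self (pow_ne_zero _ h1)]
  · intro y hy z hz h
    obtain ⟨h1, _⟩ := hprop y hy
    obtain ⟨h2, _⟩ := hprop z hz
    simp only at h
    rw [div_eq_div_iff h1 h2] at h
    linear_combination -h

lemma exists_ceil (a b : ℕ) (hb : 0 < b) : ∃ k, a ≤ k * b ∧ k * b < a + b := by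
  refine ⟨(a + b - 1) / b, ?_, ?_⟩
  · have h1 := Nat.div_add_mod (a + b - 1) b
    have h2 := Nat.mod_lt (a + b - 1) hb
    rw [mul_comm] at h1
    omega
  · have h1 := Nat.div_mul_le_self (a + b - 1) b
    omega

lemma level_bound_s17 (p : ℕ) [Fact p.Prime] (t : ℕ) (ht : 1 ≤ t) (hp : 81 * t ^ 3 ≤ p ^ 2)
    (τ : ℕ) (hτ : 1 ≤ τ) (U : Finset (ZMod p)) (hU : 0 ∉ U)
    (hUτ : ∀ u ∈ U, τ ≤ (SS p t u).card) : τ ^ 3 * U.card ≤ 625 * t ^ 2 := by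
  have hsum : ∀ V ⊆ U, V.card * τ ≤ ∑ u ∈ V, (SS p t u).card := by
    intro V hV
    have := Finset.card_nsmul_le_sum V (fun u => (SS p t u).card) τ (fun u hu => hUτ u (hV hu))
    simpa using this
  have hUt : U.card * τ ≤ t := (hsum U (Finset.Subset.refl _)).trans (sum_SS_le p t ht U hU)
  by_cases h1 : τ < 25
  · have : τ ^ 2 ≤ 625 := by nlinarith
    calc τ ^ 3 * U.card = τ ^ 2 * (U.card * τ) := by ring
      _ ≤ 625 * t := Nat.mul_le_mul this hUt
      _ ≤ 625 * t ^ 2 := by nlinarith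
  by_cases h2 : τ ^ 2 < t
  · calc τ ^ 3 * U.card = τ ^ 2 * (U.card * τ) := by ring
      _ ≤ t * t := Nat.mul_le_mul h2.le hUt
      _ ≤ 625 * t ^ 2 := by nlinarith
  push Not at h1 h2
  by_contra hcon
  push Not at hcon
  have hU1 : 1 ≤ U.card := by
    by_contra h
    have : U.card = 0 := by omega
    rw [this] at hcon
    omega
  have hτt : τ ≤ t := by nlinarith
  have hτ3 : 0 < τ ^ 3 := by positivity
  obtain ⟨k, hk1, hk2⟩ := exists_ceil (365 * t ^ 2) (τ ^ 3) hτ3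
  obtain ⟨B, hB1, hB2⟩ := exists_ceil (8 * t) τ (by omega)
  have hkU : k ≤ U.card := by
    have h3 : k * τ ^ 3 < (U.card + 1) * τ ^ 3 := by nlinarith
    have := Nat.lt_of_mul_lt_mul_right h3
    omega
  have hkpos : 1 ≤ k := by
    by_contra h
    have : k = 0 := by omega
    rw [this] at hk1
    have : 0 < t ^ 2 := by positivity
    omega
  have hBpos : 1 ≤ B := by
    by_contra h
    have : B = 0 := by omega
    rw [this] at hB1
    omega
  obtain ⟨V, hVU, hVk⟩ := Finset.exists_subset_card_eq hkU
  have hB9 : B * τ ≤ 9 * t := by omega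
  have hBk : 4 * k ≤ B ^ 2 := by
    have e1 : (8 * t) ^ 2 ≤ (B * τ) ^ 2 := Nat.pow_le_pow_left hB1 2
    have e2 : (8 * t) ^ 2 * τ ≤ (B * τ) ^ 2 * τ := Nat.mul_le_mul_right _ e1
    have e3 : τ ^ 3 ≤ t ^ 2 * τ := by
      calc τ ^ 3 = τ ^ 2 * τ := by ring
        _ ≤ t ^ 2 * τ := Nat.mul_le_mul_right _ (Nat.pow_le_pow_left hτt 2)
    have e4 : t ^ 2 * 25 ≤ t ^ 2 * τ := Nat.mul_le_mul_left _ h1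
    have e5 : 4 * k * τ ^ 3 ≤ B ^ 2 * τ ^ 3 := by
      have a1 : (B * τ) ^ 2 * τ = B ^ 2 * τ ^ 3 := by ring
      have a2 : (8 * t) ^ 2 * τ = 64 * (t ^ 2 * τ) := by ring
      rw [a1, a2] at e2
      rw [mul_assoc]
      omega
    exact Nat.le_of_mul_le_mul_right e5 hτ3
  set D := (B ^ 2 - 1) / (2 * k) with hDdef
  have hDmod := Nat.div_add_mod (B ^ 2 - 1) (2 * k)
  have hDlt := Nat.mod_lt (B ^ 2 - 1) (show 0 < 2 * k by omega)
  rw [← hDdef] at hDmod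
  clear_value D
  have hB2 : 1 ≤ B ^ 2 := Nat.one_le_pow _ _ hBpos
  generalize (B ^ 2 - 1) % (2 * k) = r at hDmod hDlt
  have hDle : 2 * k * D + 1 ≤ B ^ 2 := by omega
  have hDge : B ^ 2 ≤ 4 * (k * D) := by
    have : 2 * k * D = 2 * (k * D) := by ring
    rw [this] at hDmod
    omega
  have hDpos : 1 ≤ D := by
    by_contra h
    have : D = 0 := by omega
    rw [this] at hDge
    omega
  have hDB : D * B ≤ t := by
    have e1 : (B * τ) ^ 3 ≤ (9 * t) ^ 3 := Nat.pow_le_pow_left hB9 3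
    have e2 : D * B * (2 * (k * τ ^ 3)) ≤ B ^ 3 * τ ^ 3 := by
      calc D * B * (2 * (k * τ ^ 3)) = (2 * k * D) * (B * τ ^ 3) := by ring
        _ ≤ B ^ 2 * (B * τ ^ 3) := Nat.mul_le_mul_right _ (by omega)
        _ = B ^ 3 * τ ^ 3 := by ring
    have e3 : D * B * (2 * (k * τ ^ 3)) ≤ t * (2 * (k * τ ^ 3)) := by
      calc _ ≤ B ^ 3 * τ ^ 3 := e2
        _ = (B * τ) ^ 3 := by ring
        _ ≤ (9 * t) ^ 3 := e1
        _ = t * (729 * t ^ 2) := by ring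
        _ ≤ t * (2 * (k * τ ^ 3)) := Nat.mul_le_mul_left _ (by omega)
    exact Nat.le_of_mul_le_mul_right e3 (by positivity)
  have htB : t * B ≤ p := by
    have e1 : (t * B) ^ 2 * τ ^ 2 ≤ p ^ 2 * τ ^ 2 := by
      calc (t * B) ^ 2 * τ ^ 2 = t ^ 2 * (B * τ) ^ 2 := by ring
        _ ≤ t ^ 2 * (9 * t) ^ 2 := Nat.mul_le_mul_left _ (Nat.pow_le_pow_left hB9 2)
        _ = (81 * t ^ 3) * t := by ring
        _ ≤ p ^ 2 * τ ^ 2 := Nat.mul_le_mul hp h2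
    have e2 := Nat.le_of_mul_le_mul_right e1 (by positivity)
    exact (Nat.pow_le_pow_iff_left (by norm_num)).1 e2
  have hst := stepanov_s17 p t B D V ht hDpos hBpos hDB htB (fun h => hU (hVU h)) (by
    rw [hVk]
    have : 2 * k * D = k * (2 * D) := by ring
    omega)
  have hV := hsum V hVU
  rw [hVk] at hV
  have f1 : D * (k * τ) < 2 * (t * B) := lt_of_le_of_lt (Nat.mul_le_mul_left _ hV) hst
  have f2 : B ^ 2 * τ ≤ 4 * (k * D) * τ := Nat.mul_le_mul_right _ hDge
  have f3 : 8 * t * B ≤ B * τ * B := Nat.mul_le_mul_right _ hB1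
  nlinarith

lemma pow_four_le (n : ℕ) : n ^ 4 ≤ ∑ τ ∈ Finset.Icc 1 n, 4 * τ ^ 3 := by
  induction n with
  | zero => simp
  | succ n ih =>
    rw [Finset.sum_Icc_succ_top (by omega)]
    nlinarith [sq_nonneg n, Nat.zero_le (n ^ 3)]

lemma sum_pow_four (p : ℕ) [Fact p.Prime] (t : ℕ) (ht : 1 ≤ t) (hp : 81 * t ^ 3 ≤ p ^ 2)
    (U : Finset (ZMod p)) (hU : 0 ∉ U) :
    ∃ M : ℕ, M ^ 3 ≤ 625 * t ^ 2 ∧ ∑ u ∈ U, (SS p t u).card ^ 4 ≤ 2500 * t ^ 2 * M := by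
  refine ⟨U.sup (fun u => (SS p t u).card), ?_, ?_⟩
  · rcases U.eq_empty_or_nonempty with rfl | hne
    · simp
    obtain ⟨u, hu, h⟩ := Finset.exists_mem_eq_sup U hne (fun u => (SS p t u).card)
    rw [h]
    by_cases h0 : (SS p t u).card = 0
    · rw [h0]; simp
    have := level_bound_s17 p t ht hp (SS p t u).card (by omega) {u}
      (by
        rw [Finset.mem_singleton]
        rintro rfl
        exact hU hu) (by simp)
    simpa using this
  · set M := U.sup (fun u => (SS p t u).card) with hM
    have h1 : ∀ u ∈ U, (SS p t u).card ^ 4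
        ≤ ∑ τ ∈ Finset.Icc 1 M, if τ ≤ (SS p t u).card then 4 * τ ^ 3 else 0 := by
      intro u hu
      refine (pow_four_le _).trans ?_
      rw [← Finset.sum_filter]
      apply Finset.sum_le_sum_of_subset
      intro τ hτ
      have := Finset.le_sup (f := fun u => (SS p t u).card) hu
      simp only [Finset.mem_Icc, Finset.mem_filter] at hτ ⊢
      omega
    refine (Finset.sum_le_sum h1).trans ?_
    rw [Finset.sum_comm]
    have h2 : ∀ τ ∈ Finset.Icc 1 M,
        ∑ u ∈ U, (if τ ≤ (SS p t u).card then 4 * τ ^ 3 else 0) ≤ 2500 * t ^ 2 := by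
      intro τ hτ
      rw [← Finset.sum_filter, Finset.sum_const, smul_eq_mul]
      have := level_bound_s17 p t ht hp τ (Finset.mem_Icc.1 hτ).1
        (U.filter fun u => τ ≤ (SS p t u).card)
        (fun h => hU (Finset.mem_filter.1 h).1) (fun u hu => (Finset.mem_filter.1 hu).2)
      nlinarith
    refine (Finset.sum_le_sum h2).trans ?_
    simp
    rw [mul_comm]

lemma E4_nat (p : ℕ) [Fact p.Prime] (R : Finset (ZMod p)) (t : ℕ) (ht : 1 ≤ t)
    (hRt : R.card = t) (hR : ∀ x ∈ R, x ^ t = 1) (hp : 81 * t ^ 3 ≤ p ^ 2) :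
    ∃ M : ℕ, M ^ 3 ≤ 625 * t ^ 2 ∧
      ∑ s : ZMod p, (R ∩ R.image (fun a => a - s)).card ^ 4 ≤ t ^ 4 + t * (2500 * t ^ 2 * M) := by
  obtain ⟨M, hM, hS⟩ := sum_pow_four p t ht hp (Finset.univ.erase 0) (by simp)
  refine ⟨M, hM, ?_⟩
  rw [← Finset.add_sum_erase _ _ (Finset.mem_univ (0 : ZMod p))]
  apply Nat.add_le_add
  · apply Nat.pow_le_pow_left
    rw [← hRt]
    exact Finset.card_le_card Finset.inter_subset_left
  have h1 : ∀ s ∈ Finset.univ.erase (0 : ZMod p),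
      (R ∩ R.image (fun a => a - s)).card ^ 4 ≤ (SS p t (s⁻¹ ^ t)).card ^ 4 := by
    intro s hs
    have hs0 : s ≠ 0 := Finset.ne_of_mem_erase hs
    apply Nat.pow_le_pow_left
    apply Finset.card_le_card_of_injOn (fun x => (x + s) * s⁻¹)
    · intro x hx
      simp only [Finset.coe_inter, Finset.coe_image, Set.mem_inter_iff, Set.mem_image,
        Finset.mem_coe] at hx
      obtain ⟨hx, y, hy, hyx⟩ := hx
      have e1 : (x + s) * s⁻¹ - 1 = x * s⁻¹ := by
        field_simp
        ring
      have e2 : x + s = y := by rw [← hyx]; ring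
      simp only [SS, Finset.coe_filter, Finset.mem_univ, true_and, Set.mem_ofPred_eq]
      rw [e1, e2, mul_pow, mul_pow, hR x hx, hR y hy]
      simp
    · intro x _ y _ h
      simp only at h
      exact add_right_cancel (mul_right_cancel₀ (inv_ne_zero hs0) h)
  refine (Finset.sum_le_sum h1).trans ?_
  rw [← Finset.sum_fiberwise_of_maps_to (s := Finset.univ.erase (0 : ZMod p))
    (t := Finset.univ.erase (0 : ZMod p)) (g := fun s => s⁻¹ ^ t)]
  · refine le_trans ?_ (Nat.mul_le_mul_left t hS)
    rw [Finset.mul_sum]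
    apply Finset.sum_le_sum
    intro u _
    have h2 : ∀ s ∈ (Finset.univ.erase (0 : ZMod p)).filter (fun s => s⁻¹ ^ t = u),
        (SS p t (s⁻¹ ^ t)).card ^ 4 = (SS p t u).card ^ 4 := by
      intro s hs
      rw [(Finset.mem_filter.1 hs).2]
    rw [Finset.sum_congr rfl h2, Finset.sum_const, smul_eq_mul]
    apply Nat.mul_le_mul_right
    refine le_trans ?_ (card_pow_eq_le p t ht u)
    apply Finset.card_le_card_of_injOn (fun s => s⁻¹)
    · intro s hs
      simpa using (Finset.mem_filter.1 hs).2
    · intro x _ y _ h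
      exact inv_injective h
  · intro s hs
    have hs0 : s ≠ 0 := Finset.ne_of_mem_erase hs
    simp [hs0]

theorem subgroup_E4_bound :
    ∃ c C : ℝ, 0 < c ∧ 0 < C ∧
      ∀ (p : ℕ) [Fact p.Prime],
        ∀ R : Finset (ZMod p), IsMulSubgroup p R →
          (R.card : ℝ) ≤ c * (p : ℝ) ^ ((2 : ℝ) / 3) →
          ∑ s : ZMod p, ((R ∩ R.image (fun a => a - s)).card : ℝ) ^ 4 ≤
            (R.card : ℝ) ^ 4 + C * (R.card : ℝ) ^ ((11 : ℝ) / 3) := by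
  refine ⟨1 / 5, 22500, by norm_num, by norm_num, ?_⟩
  intro p _ R hR hcard
  obtain ⟨H, hH⟩ := hR
  have hcardH : Nat.card H = R.card := by
    have h1 : (R : Set (ZMod p)).ncard = R.card := Set.ncard_coe_finset R
    rw [hH, Set.ncard_image_of_injective _ Units.val_injective] at h1
    rw [← h1]
    exact Nat.card_coe_set_eq (H : Set (ZMod p)ˣ)
  have hpow : ∀ x ∈ R, x ^ R.card = 1 := by
    intro x hx
    have hx' : x ∈ (R : Set (ZMod p)) := hx
    rw [hH] at hx'
    obtain ⟨g, hg, rfl⟩ := hx'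
    have h1 : (⟨g, hg⟩ : H) ^ Nat.card H = 1 := pow_card_eq_one'
    rw [hcardH] at h1
    have h2 := congrArg (fun z : H => ((z : (ZMod p)ˣ) : ZMod p)) h1
    simpa using h2
  have h1R : 1 ≤ R.card := by
    rw [← hcardH]
    exact Nat.card_pos
  set t := R.card with ht
  have ht0 : (0 : ℝ) ≤ (t : ℝ) := Nat.cast_nonneg _
  have ht1 : (0 : ℝ) < (t : ℝ) := by exact_mod_cast h1R
  have hp : 81 * t ^ 3 ≤ p ^ 2 := by
    have h1 : (t : ℝ) ^ 3 ≤ (1 / 5 * (p : ℝ) ^ ((2 : ℝ) / 3)) ^ 3 :=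
      pow_le_pow_left₀ ht0 hcard 3
    have h2 : ((p : ℝ) ^ ((2 : ℝ) / 3)) ^ 3 = (p : ℝ) ^ 2 := by
      rw [← Real.rpow_natCast, ← Real.rpow_mul (Nat.cast_nonneg _), ← Real.rpow_natCast]
      norm_num
    rw [mul_pow, h2] at h1
    have h3 : (81 : ℝ) * (t : ℝ) ^ 3 ≤ (p : ℝ) ^ 2 := by
      have : (0 : ℝ) ≤ (p : ℝ) ^ 2 := by positivity
      linarith
    exact_mod_cast h3
  obtain ⟨M, hM, hS⟩ := E4_nat p R t h1R ht.symm hpow hp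
  have hM' : (M : ℝ) ≤ 9 * (t : ℝ) ^ ((2 : ℝ) / 3) := by
    have h2 : ((t : ℝ) ^ ((2 : ℝ) / 3)) ^ 3 = (t : ℝ) ^ 2 := by
      rw [← Real.rpow_natCast, ← Real.rpow_mul ht0, ← Real.rpow_natCast]
      norm_num
    have h3 : (M : ℝ) ^ 3 ≤ 625 * (t : ℝ) ^ 2 := by exact_mod_cast hM
    have h4 : (M : ℝ) ^ 3 ≤ (9 * (t : ℝ) ^ ((2 : ℝ) / 3)) ^ 3 := by
      rw [mul_pow, h2]
      have : (0 : ℝ) ≤ (t : ℝ) ^ 2 := by positivity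
      linarith
    exact le_of_pow_le_pow_left₀ (by norm_num) (by positivity) h4
  have hS' : ∑ s : ZMod p, ((R ∩ R.image (fun a => a - s)).card : ℝ) ^ 4
      ≤ (t : ℝ) ^ 4 + t * (2500 * (t : ℝ) ^ 2 * M) := by exact_mod_cast hS
  refine hS'.trans ?_
  have h5 : (t : ℝ) ^ ((11 : ℝ) / 3) = (t : ℝ) ^ 3 * (t : ℝ) ^ ((2 : ℝ) / 3) := by
    rw [← Real.rpow_natCast, ← Real.rpow_add ht1]
    norm_num
  rw [h5]
  have h6 : (t : ℝ) ^ 3 * M ≤ (t : ℝ) ^ 3 * (9 * (t : ℝ) ^ ((2 : ℝ) / 3)) :=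
    mul_le_mul_of_nonneg_left hM' (by positivity)
  linarith
end
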